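/- arXiv:2508.02859 — 6 statements merged into one kernel-verified Lean document; each statement's English description precedes it below -/
import Mathlib

section
/- Let p be an odd prime, q = p^r with q ≡ 3 (mod 4), and s = v₂(q+1)+1. Let k be a field of characteristic ≠ 2 and let ξ be a primitive 2^{s−1}-th root of unity in a fixed algebraic closure of k. Let P be any Sylow 2-subgroup of SL₂(F_q). Then the minimal faithful representation dimension of P over k equals: 2·[k(ξ):k] if there is no k-algebra automorphism of k(ξ) sending ξ to ξ⁻¹; [k(ξ):k] if such an automorphism exists and the equation x² + y² = −1 has a solution with x, y ∈ k(ξ+ξ⁻¹); and 2·[k(ξ):k] if such an automorphism exists and x² + y² = −1 has no solution in k(ξ+ξ⁻¹). -/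
open IntermediateField

/-- The minimal faithful representation dimension of a group `G` over a field `k`:
the least `d` such that there is an injective group homomorphism `G →* GL d k`. -/
noncomputable def minFaithfulDim (k : Type*) [Field k] (G : Type*) [Group G] : ℕ :=
  sInf {d : ℕ | ∃ φ : G →* Matrix.GeneralLinearGroup (Fin d) k, Function.Injective φ}

theorem QuaternionGroup.exists_injective_monoidHom {H : Type*} [Group H] {n : ℕ} [NeZero n]
    {X Y : H} (hX : orderOf X = 2 * n) (hY : Y ^ 2 = X ^ n) (hXY : X * Y * X = Y) :
    ∃ f : QuaternionGroup n →* H, Function.Injective f := by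
  have hX1 : X ^ (2 * n) = 1 := hX ▸ pow_orderOf_eq_one X
  have hn : (0 : ℕ) < n := Nat.pos_of_ne_zero (NeZero.ne n)
  have hXn : X ^ n ≠ 1 := fun h => by
    have := orderOf_dvd_of_pow_eq_one h
    rw [hX] at this
    have := Nat.le_of_dvd hn this
    omega
  let Z : ZMod (2 * n) → H := fun i => X ^ i.val
  have hmod : ∀ m, X ^ (m % (2 * n)) = X ^ m := fun m => hX ▸ pow_mod_orderOf X m
  have Zadd : ∀ i j, Z (i + j) = Z i * Z j := fun i j => by
    simp only [Z, ZMod.val_add, ← pow_add, hmod]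
  have Z0 : Z 0 = 1 := by simp [Z]
  have Zneg : ∀ i, Z (-i) = (Z i)⁻¹ := fun i => by
    rw [eq_inv_iff_mul_eq_one, ← Zadd, neg_add_cancel, Z0]
  have Zn : Z n = X ^ n := by
    simp only [Z, ZMod.val_natCast, hmod]
  have hpow : ∀ m : ℕ, X ^ m * Y * X ^ m = Y := fun m => by
    induction m with
    | zero => simp
    | succ m ih =>
      calc X ^ (m + 1) * Y * X ^ (m + 1) = X ^ m * (X * Y * X) * X ^ m := by
            rw [pow_succ X m]; nth_rewrite 2 [← pow_succ]; rw [pow_succ']; group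
        _ = Y := by rw [hXY, ih]
  have ZY : ∀ i, Z i * Y = Y * Z (-i) := fun i => by
    rw [Zneg, eq_mul_inv_iff_mul_eq]; exact hpow _
  let f : QuaternionGroup n →* H :=
    MonoidHom.mk' (fun g => match g with
      | .a i => Z i
      | .xa i => Y * Z i) (by
      rintro (i | i) (j | j)
      · simp [QuaternionGroup.a_mul_a, Zadd]
      · simp [QuaternionGroup.a_mul_xa, sub_eq_add_neg, Zadd, ← mul_assoc, ZY]
        simp [mul_assoc, ← Zadd, add_comm]
      · simp [QuaternionGroup.xa_mul_a, Zadd, mul_assoc]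
      · have : Y * Z i * (Y * Z j) = Y ^ 2 * (Z (-i) * Z j) := by
          rw [mul_assoc, ← mul_assoc (Z i), ZY, sq]; group
        simp only [QuaternionGroup.xa_mul_xa]
        rw [this, hY, ← Zn, ← Zadd, ← Zadd]
        congr 1; ring)
  refine ⟨f, (injective_iff_map_eq_one f).2 ?_⟩
  rintro (i | i) h
  · have h' : X ^ i.val = 1 := h
    have := orderOf_dvd_of_pow_eq_one h'
    rw [hX] at this
    have h0 := Nat.eq_zero_of_dvd_of_lt this (ZMod.val_lt i)
    rw [(ZMod.val_eq_zero i).1 h0]; rfl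
  · exfalso
    have h2 : f (QuaternionGroup.xa i ^ 2) = 1 := by rw [map_pow, h, one_pow]
    rw [QuaternionGroup.xa_sq] at h2
    exact hXn (Zn ▸ h2)

open Matrix in
theorem Matrix.SpecialLinearGroup.natCard_mul_natCard_units (F : Type*) [Field F] :
    Nat.card (SpecialLinearGroup (Fin 2) F) * Nat.card Fˣ = Nat.card (GL (Fin 2) F) := by
  have hs : Function.Surjective (GeneralLinearGroup.det : GL (Fin 2) F →* Fˣ) := fun u => by
    refine ⟨GeneralLinearGroup.mkOfDetNeZero !![(u : F), 0; 0, 1] (by simp), ?_⟩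
    ext; simp [GeneralLinearGroup.mkOfDetNeZero]
  have hr : (SpecialLinearGroup.toGL : SpecialLinearGroup (Fin 2) F →* GL (Fin 2) F).range =
      (GeneralLinearGroup.det : GL (Fin 2) F →* Fˣ).ker := by
    ext g
    constructor
    · rintro ⟨x, rfl⟩
      simp [MonoidHom.mem_ker]
    · intro hg
      refine ⟨⟨g, congrArg Units.val hg⟩, ?_⟩
      ext; rfl
  rw [Nat.card_congr (MonoidHom.ofInjective SpecialLinearGroup.toGL_injective).toEquiv, hr,
    ← Nat.card_congr (QuotientGroup.quotientKerEquivOfSurjective _ hs).toEquiv, mul_comm,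
    ← Subgroup.card_eq_card_quotient_mul_card_subgroup]

open Matrix in
theorem Matrix.SpecialLinearGroup.natCard_fin_two (F : Type*) [Field F] [Fintype F] :
    Nat.card (SpecialLinearGroup (Fin 2) F) =
      Fintype.card F * ((Fintype.card F + 1) * (Fintype.card F - 1)) := by
  have h := natCard_mul_natCard_units F
  have h1 := Fintype.one_lt_card (α := F)
  rw [Matrix.card_GL_field, Nat.card_units, Nat.card_eq_fintype_card (α := F)] at h
  have h0 : 0 < Fintype.card F - 1 := by omega
  refine Nat.eq_of_mul_eq_mul_right h0 (h.trans ?_)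
  simp only [Fin.prod_univ_two]
  obtain ⟨m, hm⟩ : ∃ m, Fintype.card F = m + 1 := ⟨_, (Nat.succ_pred_eq_of_pos (by omega)).symm⟩
  rw [hm]
  have e1 : (m + 1) ^ 2 - (m + 1) ^ ((0 : Fin 2) : ℕ) = (m + 2) * m := by
    simp [show (m + 1) ^ 2 = (m + 2) * m + 1 by ring]
  have e2 : (m + 1) ^ 2 - (m + 1) ^ ((1 : Fin 2) : ℕ) = (m + 1) * m := by
    simp [show (m + 1) ^ 2 = (m + 1) * m + (m + 1) by ring]
  rw [e1, e2]; simp; ring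

theorem QuadraticAlgebra.pow_card_eq_star {F : Type*} [Field F] [Fintype F]
    (hF : Fintype.card F % 4 = 3) [Fact (∀ r : F, r ^ 2 ≠ -1 + 0 * r)]
    (z : QuadraticAlgebra F (-1) 0) : z ^ Fintype.card F = star z := by
  obtain ⟨p, hp⟩ := CharP.exists F
  have := hp
  obtain ⟨n, hpp, hn⟩ := FiniteField.card F p
  have : Fact p.Prime := ⟨hpp⟩
  have : CharP (QuadraticAlgebra F (-1) 0) p :=
    charP_of_injective_algebraMap (algebraMap F (QuadraticAlgebra F (-1) 0)).injective p
  let ω : QuadraticAlgebra F (-1) 0 := ⟨0, 1⟩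
  have hω : ω ^ 2 = -1 := by ext <;> simp [ω, sq]
  have hωq : ω ^ Fintype.card F = -ω := by
    conv_lhs => rw [← Nat.div_add_mod (Fintype.card F) 4, hF]
    rw [pow_add, pow_mul, show ω ^ 4 = (ω ^ 2) ^ 2 by ring, hω, pow_succ ω 2, hω]; simp
  have hz : z = algebraMap F (QuadraticAlgebra F (-1) 0) z.re +
      algebraMap F (QuadraticAlgebra F (-1) 0) z.im * ω := by
    ext <;> simp [ω]
  conv_lhs => rw [hz]
  rw [hn, add_pow_char_pow, ← hn, mul_pow, hωq, ← map_pow, ← map_pow, FiniteField.pow_card,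
    FiniteField.pow_card]
  ext <;> simp [ω]

open Matrix in
theorem Matrix.SpecialLinearGroup.exists_orderOf_eq_two_pow {F : Type*} [Field F] [Fintype F]
    (hF : Fintype.card F % 4 = 3) {t : ℕ} (ht : 1 ≤ t) (hd : 2 ^ t ∣ Fintype.card F + 1) :
    ∃ X Y : SpecialLinearGroup (Fin 2) F,
      orderOf X = 2 ^ t ∧ Y ^ 2 = X ^ (2 ^ (t - 1)) ∧ X * Y * X = Y := by
  have hns : ¬ IsSquare (-1 : F) := by
    rw [FiniteField.isSquare_neg_one_iff]; simpa using hF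
  have : Fact (∀ r : F, r ^ 2 ≠ -1 + 0 * r) :=
    ⟨fun r h => hns ⟨r, by rw [← sq, h]; ring⟩⟩
  have : Fintype (QuadraticAlgebra F (-1) 0) :=
    Fintype.ofEquiv _ (QuadraticAlgebra.equivProd (-1 : F) 0).symm
  have hcard : Fintype.card (QuadraticAlgebra F (-1) 0) = Fintype.card F ^ 2 := by
    rw [Fintype.card_congr (QuadraticAlgebra.equivProd (-1 : F) 0), Fintype.card_prod, sq]
  have h1 := Fintype.one_lt_card (α := F)
  obtain ⟨g, hg⟩ := IsCyclic.exists_ofOrder_eq_natCard (α := (QuadraticAlgebra F (-1) 0)ˣ)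
  have hog : orderOf g = (Fintype.card F + 1) * (Fintype.card F - 1) := by
    rw [hg, Nat.card_units, Nat.card_eq_fintype_card, hcard]
    exact Nat.sq_sub_sq _ 1
  obtain ⟨c, hc⟩ := hd
  have hc0 : c * (Fintype.card F - 1) ≠ 0 := by
    refine mul_ne_zero ?_ (by omega)
    rintro rfl; omega
  have hou : orderOf (g ^ (c * (Fintype.card F - 1))) = 2 ^ t := by
    rw [orderOf_pow_of_dvd hc0 ⟨2 ^ t, by rw [hog, hc]; ring⟩, hog, hc]
    rw [mul_assoc]
    exact Nat.mul_div_cancel _ (Nat.pos_of_ne_zero hc0)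
  set u := g ^ (c * (Fintype.card F - 1)) with hu
  have re1 : (1 : QuadraticAlgebra F (-1) 0).re = 1 := rfl
  have im1 : (1 : QuadraticAlgebra F (-1) 0).im = 0 := rfl
  have hnorm : ∀ v : (QuadraticAlgebra F (-1) 0)ˣ, v ^ (2 ^ t) = 1 →
      (v : QuadraticAlgebra F (-1) 0).re ^ 2 +
        (v : QuadraticAlgebra F (-1) 0).im ^ 2 = 1 := fun v hv => by
    have h : (v : QuadraticAlgebra F (-1) 0) * star (v : QuadraticAlgebra F (-1) 0) = 1 := by
      rw [← QuadraticAlgebra.pow_card_eq_star hF, ← pow_succ', hc, pow_mul]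
      rw [← Units.val_pow_eq_pow_val, hv]; simp
    have := congrArg QuadraticAlgebra.re h
    simp [re1] at this
    linear_combination this
  let M : QuadraticAlgebra F (-1) 0 →* Matrix (Fin 2) (Fin 2) F :=
    { toFun := fun z => !![z.re, -z.im; z.im, z.re]
      map_one' := by ext i j; fin_cases i <;> fin_cases j <;> simp [re1, im1]
      map_mul' := fun z w => by
        ext i j; fin_cases i <;> fin_cases j <;> simp [Matrix.mul_apply] <;> ring }
  have hMinj : Function.Injective M := fun z w h => by
    have h0 := congrFun (congrFun h 0) 0
    have h1 := congrFun (congrFun h 1) 0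
    exact QuadraticAlgebra.ext h0 h1
  have hun := hnorm u (hou ▸ pow_orderOf_eq_one u)
  let X : SpecialLinearGroup (Fin 2) F := ⟨M u, by
    simp [M, Matrix.det_fin_two]; linear_combination hun⟩
  have hXM : ∀ n, ((X ^ n : SpecialLinearGroup (Fin 2) F) : Matrix (Fin 2) (Fin 2) F) =
      M (u ^ n : (QuadraticAlgebra F (-1) 0)ˣ) :=
    fun n => by rw [Matrix.SpecialLinearGroup.coe_pow, Units.val_pow_eq_pow_val, map_pow]
  have hoX : orderOf X = 2 ^ t := by
    rw [← hou]
    refine orderOf_eq_orderOf_iff.2 fun n => ?_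
    have : X ^ n = 1 ↔ ((X ^ n : SpecialLinearGroup (Fin 2) F) : Matrix (Fin 2) (Fin 2) F) = 1 :=
      ⟨fun h => by rw [h]; rfl, fun h => Subtype.ext h⟩
    rw [this, hXM, ← map_one M, hMinj.eq_iff, Units.val_eq_one]
  obtain ⟨a, b, hab⟩ : ∃ a b : F, a ^ 2 + b ^ 2 = -1 := by
    obtain ⟨p, hp⟩ := CharP.exists F
    have := hp
    have : NeZero p := ⟨by rintro rfl; exact CharP.char_ne_zero_of_finite F 0 rfl⟩
    have : Fact p.Prime := ⟨CharP.char_is_prime F p⟩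
    obtain ⟨a, b, h⟩ := ZMod.sq_add_sq p (-1)
    refine ⟨ZMod.castHom (dvd_refl p) F a, ZMod.castHom (dvd_refl p) F b, ?_⟩
    rw [← map_pow, ← map_pow, ← map_add, h]; simp
  let Y : SpecialLinearGroup (Fin 2) F := ⟨!![a, b; b, -a], by
    rw [Matrix.det_fin_two_of]; linear_combination -hab⟩
  have hu1 : ((u ^ 2 ^ (t - 1) : (QuadraticAlgebra F (-1) 0)ˣ) :
      QuadraticAlgebra F (-1) 0) = -1 := by
    have h2 : (u ^ 2 ^ (t - 1)) ^ 2 = 1 := by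
      rw [← pow_mul, ← pow_succ, Nat.sub_add_cancel ht, ← hou, pow_orderOf_eq_one]
    have h3 : u ^ 2 ^ (t - 1) ≠ 1 := fun h => by
      have := orderOf_dvd_of_pow_eq_one h
      rw [hou, Nat.pow_dvd_pow_iff_le_right (by norm_num)] at this
      omega
    have h4 : ((u ^ 2 ^ (t - 1) : (QuadraticAlgebra F (-1) 0)ˣ) :
        QuadraticAlgebra F (-1) 0) ^ 2 = 1 := by
      rw [← Units.val_pow_eq_pow_val, h2, Units.val_one]
    exact (sq_eq_one_iff.1 h4).resolve_left fun h => h3 (Units.ext h)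
  refine ⟨X, Y, hoX, ?_, ?_⟩
  · apply Subtype.ext
    rw [hXM, hu1, Matrix.SpecialLinearGroup.coe_pow]
    ext i j; fin_cases i <;> fin_cases j <;> simp [M, Y, sq, re1, im1] <;>
      first | linear_combination hab | ring
  · apply Subtype.ext
    rw [Matrix.SpecialLinearGroup.coe_mul, Matrix.SpecialLinearGroup.coe_mul]
    ext i j; fin_cases i <;> fin_cases j <;> simp [M, X, Y, Matrix.mul_apply, Fin.sum_univ_two]
    · linear_combination a * hun
    · linear_combination b * hun
    · linear_combination b * hun
    · linear_combination -a * hun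

theorem Sylow.nonempty_mulEquiv_quaternionGroup {F : Type*} [Field F] [Fintype F]
    (hF : Fintype.card F % 4 = 3) {m : ℕ} (hm : padicValNat 2 (Fintype.card F + 1) = m + 1)
    (P : Sylow 2 (Matrix.SpecialLinearGroup (Fin 2) F)) :
    Nonempty (QuaternionGroup (2 ^ m) ≃* P) := by
  have hd : 2 ^ (m + 1) ∣ Fintype.card F + 1 := hm ▸ pow_padicValNat_dvd
  obtain ⟨X, Y, hX, hY, hXY⟩ :=
    Matrix.SpecialLinearGroup.exists_orderOf_eq_two_pow hF (Nat.succ_pos m) hd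
  obtain ⟨f, hf⟩ := QuaternionGroup.exists_injective_monoidHom (n := 2 ^ m)
    (by rw [hX, pow_succ']) hY hXY
  have hcard : Nat.card f.range =
      2 ^ (Nat.card (Matrix.SpecialLinearGroup (Fin 2) F)).factorization 2 := by
    rw [← Nat.card_congr (MonoidHom.ofInjective hf).toEquiv, Nat.card_eq_fintype_card,
      QuaternionGroup.card, Matrix.SpecialLinearGroup.natCard_fin_two]
    have h1 := Fintype.one_lt_card (α := F)
    obtain ⟨w, hw⟩ : ∃ w, Fintype.card F = 4 * w + 3 := ⟨Fintype.card F / 4, by omega⟩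
    rw [Nat.factorization_mul (by omega) (mul_ne_zero (by omega) (by omega)),
      Nat.factorization_mul (by omega) (by omega)]
    have e1 : (Fintype.card F).factorization 2 = 0 :=
      Nat.factorization_eq_zero_of_not_dvd (by omega)
    have e2 : (Fintype.card F + 1).factorization 2 = m + 1 := by
      rw [← hm, Nat.factorization_def _ Nat.prime_two]
    have e3 : (Fintype.card F - 1).factorization 2 = 1 := by
      rw [hw, show 4 * w + 3 - 1 = 2 * (2 * w + 1) by omega,
        Nat.factorization_mul (by omega) (by omega), Finsupp.add_apply,
        Nat.factorization_eq_zero_of_not_dvd (show ¬ 2 ∣ 2 * w + 1 by omega),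
        Nat.prime_two.factorization_self]
    rw [Finsupp.add_apply, Finsupp.add_apply, e1, e2, e3]
    ring
  exact ⟨(MonoidHom.ofInjective hf).trans (Sylow.equiv (Sylow.ofCard f.range hcard) P)⟩

open Polynomial in
theorem Module.End.exists_irreducible_aeval_apply_eq_zero {k V : Type*} [Field k] [AddCommGroup V]
    [Module k V] (M : Module.End k V) (p : k[X]) (hp : p ≠ 0) {v : V} (hv : v ≠ 0)
    (h : aeval M p v = 0) :
    ∃ g : k[X], Irreducible g ∧ g ∣ p ∧ ∃ w ≠ 0, aeval M g w = 0 := by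
  induction p using UniqueFactorizationMonoid.induction_on_prime with
  | h₁ => exact absurd rfl hp
  | h₂ x hx =>
    obtain ⟨y, hy⟩ := hx.exists_left_inv
    refine absurd ?_ hv
    rw [← Module.End.one_apply (R := k) v, ← map_one (aeval (R := k) M), ← hy, map_mul,
      Module.End.mul_apply, h, map_zero]
  | h₃ a g ha hg ih =>
    rw [map_mul, Module.End.mul_apply] at h
    by_cases h0 : aeval M a v = 0
    · obtain ⟨g', hg', hd, hw⟩ := ih ha h0
      exact ⟨g', hg', hd.mul_left g, hw⟩
    · exact ⟨g, hg.irreducible, dvd_mul_right g a, _, h0, h⟩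

theorem IsPrimitiveRoot.pow_two_pow_eq_neg_one {R : Type*} [CommRing R] [IsDomain R] {ξ : R} {m : ℕ}
    (hξ : IsPrimitiveRoot ξ (2 ^ (m + 1))) : ξ ^ 2 ^ m = -1 := by
  have h : (ξ ^ 2 ^ m) ^ 2 = 1 := by rw [← pow_mul, ← pow_succ, hξ.pow_eq_one]
  refine (sq_eq_one_iff.1 h).resolve_left fun h1 => ?_
  have := (Nat.pow_dvd_pow_iff_le_right (by norm_num)).1 (hξ.dvd_of_pow_eq_one _ h1)
  omega

open Polynomial in
theorem Module.End.exists_odd_aeval_minpoly_apply_eq_zero {k V L : Type*} [Field k] [AddCommGroup V]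
    [Module k V] [Field L] [Algebra k L] [IsAlgClosed L] {m : ℕ} {ξ : L}
    (hξ : IsPrimitiveRoot ξ (2 ^ (m + 1))) {M : Module.End k V}
    (hM : M ^ 2 ^ m ≠ 1) (hM' : M ^ 2 ^ (m + 1) = 1) :
    ∃ j : ℕ, Odd j ∧ ∃ v ≠ 0, aeval (M ^ j) (minpoly k ξ) v = 0 := by
  have h2 : (1 : L) ≠ -1 := fun h => by
    have h1 := hξ.pow_two_pow_eq_neg_one
    rw [← h] at h1
    have := (Nat.pow_dvd_pow_iff_le_right (by norm_num)).1 (hξ.dvd_of_pow_eq_one _ h1)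
    omega
  obtain ⟨w, hw⟩ : ∃ w, (M ^ 2 ^ m) w ≠ w := by
    by_contra! h
    exact hM (LinearMap.ext h)
  have hpm : (X ^ 2 ^ m + 1 : k[X]).Monic := monic_X_pow_add_C 1 (by positivity)
  obtain ⟨g, hg, hgd, v, hv, hgv⟩ := M.exists_irreducible_aeval_apply_eq_zero (X ^ 2 ^ m + 1)
    hpm.ne_zero (sub_ne_zero.2 hw) (by
      have : (M ^ 2 ^ m) ((M ^ 2 ^ m) w) = w := by
        rw [← Module.End.mul_apply, ← sq, ← pow_mul, ← pow_succ, hM', Module.End.one_apply]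
      simp [this])
  obtain ⟨η, hη⟩ := IsAlgClosed.exists_aeval_eq_zero L g hg.degree_pos.ne'
  have hη1 : η ^ 2 ^ m = -1 := by
    obtain ⟨q, hq⟩ := hgd
    have := congrArg (aeval η) hq
    rw [map_mul, hη, zero_mul] at this
    simp at this
    linear_combination this
  have hηp : IsPrimitiveRoot η (2 ^ (m + 1)) := by
    rw [IsPrimitiveRoot.iff_orderOf]
    refine orderOf_eq_prime_pow (by rw [hη1]; exact h2.symm) ?_
    rw [pow_succ, pow_mul, hη1]; norm_num
  obtain ⟨j, -, hj⟩ := hηp.eq_pow_of_pow_eq_one hξ.pow_eq_one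
  refine ⟨j, ?_, v, hv, ?_⟩
  · by_contra hodd
    have h1 := hξ.pow_two_pow_eq_neg_one
    rw [← hj, ← pow_mul, mul_comm, pow_mul, hη1, (Nat.not_odd_iff_even.1 hodd).neg_one_pow] at h1
    exact h2 h1
  · have hd : g ∣ (minpoly k ξ).comp (X ^ j) := by
      rw [← hg.dvd_iff_aeval_eq_zero hη, aeval_comp, map_pow, aeval_X, hj, minpoly.aeval]
    obtain ⟨q, hq⟩ := hd
    have : aeval (M ^ j) (minpoly k ξ) = aeval M ((minpoly k ξ).comp (X ^ j)) := by
      rw [aeval_comp]; simp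
    rw [this, hq, mul_comm, map_mul, Module.End.mul_apply, hgv, map_zero]

open Polynomial in
theorem IntermediateField.exists_aeval_gen_eq {k L : Type*} [Field k] [Field L] [Algebra k L]
    {ξ : L} (hξ : IsIntegral k ξ) (u : k⟮ξ⟯) : ∃ f : k[X], aeval (AdjoinSimple.gen k ξ) f = u := by
  obtain ⟨f, hf⟩ := (adjoin.powerBasis hξ).exists_eq_aeval' u
  exact ⟨f, by rw [hf, adjoin.powerBasis_gen]⟩

open Polynomial in
theorem LinearMap.aeval_apply_of_semiconj {k V K : Type*} [Field k] [AddCommGroup V] [Module k V]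
    [CommRing K] [Algebra k K] {ι : K →ₗ[k] V} {X : Module.End k V} {z : K}
    (h : ∀ u, X (ι u) = ι (z * u)) (f : k[X]) (u : K) : aeval X f (ι u) = ι (aeval z f * u) := by
  induction f using Polynomial.induction_on' generalizing u with
  | add p q hp hq => simp [hp, hq, add_mul]
  | monomial n a =>
    have hn : ∀ u, (X ^ n) (ι u) = ι (z ^ n * u) := by
      induction n with
      | zero => simp
      | succ n ih => intro u; rw [pow_succ, Module.End.mul_apply, h, ih]; congr 1; ring
    simp [aeval_monomial, hn, ← Algebra.smul_def]

open Polynomial in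
theorem Module.End.exists_injective_of_aeval_minpoly {k V L : Type*} [Field k] [AddCommGroup V]
    [Module k V] [Field L] [Algebra k L] {ξ : L} (hξ : IsIntegral k ξ) {M : Module.End k V}
    {v : V} (hv : v ≠ 0) (h : aeval M (minpoly k ξ) v = 0) :
    ∃ ι : k⟮ξ⟯ →ₗ[k] V, Function.Injective ι ∧
      ∀ u, M (ι u) = ι (AdjoinSimple.gen k ξ * u) := by
  let A : k[X] →ₗ[k] k⟮ξ⟯ := (aeval (AdjoinSimple.gen k ξ)).toLinearMap
  let B : k[X] →ₗ[k] V := (LinearMap.applyₗ v).comp (aeval M).toLinearMap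
  have hA : Function.Surjective A := exists_aeval_gen_eq hξ
  have hker : ∀ f, A f = 0 ↔ minpoly k ξ ∣ f := fun f => by
    rw [← minpoly_gen k ξ]
    exact (minpoly.dvd_iff).symm
  have hAB : A.ker = B.ker := by
    ext f
    rw [LinearMap.mem_ker, LinearMap.mem_ker, hker]
    constructor
    · rintro ⟨q, rfl⟩
      change aeval M _ v = 0
      rw [mul_comm, map_mul, Module.End.mul_apply, h, map_zero]
    · intro hf
      change aeval M f v = 0 at hf
      by_contra hnd
      obtain ⟨a, b, hab⟩ := ((minpoly.irreducible hξ).coprime_iff_not_dvd).2 hnd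
      refine hv ?_
      have := congrArg (fun p => aeval M p v) hab
      simpa [h, hf] using this.symm
  let ι := (A.ker.liftQ B hAB.le).comp (A.quotKerEquivOfSurjective hA).symm.toLinearMap
  have hι : ∀ f, ι (A f) = B f := fun f => by
    have : (A.quotKerEquivOfSurjective hA).symm (A f) = Submodule.Quotient.mk f := by
      rw [LinearEquiv.symm_apply_eq]; rfl
    simp [ι, this]
  refine ⟨ι, (injective_iff_map_eq_zero ι).2 fun u hu => ?_, fun u => ?_⟩
  · obtain ⟨f, rfl⟩ := hA u
    rw [hι] at hu
    rwa [← LinearMap.mem_ker, hAB, LinearMap.mem_ker]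
  · obtain ⟨f, rfl⟩ := hA u
    have : AdjoinSimple.gen k ξ * A f = A (X * f) := by simp [A]
    rw [this, hι, hι]
    simp [B]

open Polynomial in
theorem IntermediateField.exists_algEquiv_of_aeval_minpoly {k L : Type*} [Field k] [Field L]
    [Algebra k L] {ξ : L} (hξ : IsIntegral k ξ) {z : k⟮ξ⟯} (hz : aeval z (minpoly k ξ) = 0) :
    ∃ σ : k⟮ξ⟯ ≃ₐ[k] k⟮ξ⟯, σ (AdjoinSimple.gen k ξ) = z := by
  have := adjoin.finiteDimensional hξ
  let σ : k⟮ξ⟯ →ₐ[k] k⟮ξ⟯ := (adjoin.powerBasis hξ).lift z (by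
    rwa [adjoin.powerBasis_gen, minpoly_gen])
  refine ⟨AlgEquiv.ofBijective σ σ.bijective, ?_⟩
  exact (congrArg σ (adjoin.powerBasis_gen hξ)).symm.trans
    ((adjoin.powerBasis hξ).lift_gen z (by rwa [adjoin.powerBasis_gen, minpoly_gen]))

open Polynomial in
theorem exists_algEquiv_mul_eq_neg_one_of_finrank_lt {k V L : Type*} [Field k] [AddCommGroup V]
    [Module k V] [FiniteDimensional k V] [Field L] [Algebra k L] {ξ : L} (hξ : IsIntegral k ξ)
    (hξ0 : ξ ≠ 0)
    {X Xi Y : Module.End k V} (hXi : Xi * X = 1) (hYX : Y * X = Xi * Y)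
    {ι : k⟮ξ⟯ →ₗ[k] V} (hι : Function.Injective ι)
    (hιX : ∀ u, X (ι u) = ι (AdjoinSimple.gen k ξ * u)) (hιY : ∀ u, Y (Y (ι u)) = - ι u)
    (hlt : Module.finrank k V < 2 * Module.finrank k k⟮ξ⟯) :
    ∃ σ : k⟮ξ⟯ ≃ₐ[k] k⟮ξ⟯, σ (AdjoinSimple.gen k ξ) = (AdjoinSimple.gen k ξ)⁻¹ ∧
      ∃ c, c * σ c = -1 := by
  have := adjoin.finiteDimensional hξ
  have hg0 : AdjoinSimple.gen k ξ ≠ 0 := fun h => hξ0 (by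
    rw [← AdjoinSimple.coe_gen k ξ, h]; rfl)
  have hYι : Function.Injective (Y ∘ₗ ι) := (injective_iff_map_eq_zero _).2 fun u hu => by
    have h := hιY u
    rw [show Y (ι u) = 0 from hu, map_zero, zero_eq_neg] at h
    exact (injective_iff_map_eq_zero ι).1 hι u h
  obtain ⟨a, b, hb, hab⟩ : ∃ a b, b ≠ 0 ∧ ι a = Y (ι b) := by
    by_contra! hno
    have hdis : Disjoint ι.range (Y ∘ₗ ι).range := by
      rw [Submodule.disjoint_def]
      rintro _ ⟨a, rfl⟩ ⟨b, hb⟩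
      by_cases h0 : b = 0
      · rw [← hb, h0, map_zero]
      · exact absurd hb.symm (hno a b h0)
    have := Submodule.finrank_add_finrank_le_of_disjoint hdis
    rw [LinearMap.finrank_range_of_inj hι, LinearMap.finrank_range_of_inj hYι] at this
    omega
  have ha : a ≠ 0 := by
    rintro rfl
    rw [map_zero] at hab
    exact hb (hYι (by simp [← hab]))
  have hιXi : ∀ u, Xi (ι u) = ι ((AdjoinSimple.gen k ξ)⁻¹ * u) := fun u => by
    have h := hιX ((AdjoinSimple.gen k ξ)⁻¹ * u)
    rw [mul_inv_cancel_left₀ hg0] at h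
    rw [← h, ← Module.End.mul_apply, hXi, Module.End.one_apply]
  have hYf : ∀ f : k[X], Y * aeval X f = aeval Xi f * Y := fun f => by
    induction f using Polynomial.induction_on' with
    | add p q hp hq => simp [mul_add, add_mul, hp, hq]
    | monomial n c =>
      have hn : Y * X ^ n = Xi ^ n * Y := SemiconjBy.pow_right (show SemiconjBy Y X Xi from hYX) n
      rw [aeval_monomial, aeval_monomial, ← mul_assoc, ← Algebra.commutes, mul_assoc, hn, mul_assoc]
  have key : ∀ f : k[X], Y (ι (aeval (AdjoinSimple.gen k ξ) f * b)) =
      ι (aeval (AdjoinSimple.gen k ξ)⁻¹ f * a) := fun f => by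
    rw [← LinearMap.aeval_apply_of_semiconj hιX, ← LinearMap.aeval_apply_of_semiconj hιXi, hab,
      ← Module.End.mul_apply, hYf, Module.End.mul_apply]
  have hz : aeval (AdjoinSimple.gen k ξ)⁻¹ (minpoly k ξ) = 0 := by
    have h := key (minpoly k ξ)
    rw [← minpoly_gen k ξ, minpoly.aeval, zero_mul, map_zero, map_zero, eq_comm] at h
    rw [← minpoly_gen k ξ]
    exact (mul_eq_zero.1 ((injective_iff_map_eq_zero ι).1 hι _ h)).resolve_right ha
  obtain ⟨σ, hσ⟩ := exists_algEquiv_of_aeval_minpoly hξ hz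
  refine ⟨σ, hσ, a / b, ?_⟩
  obtain ⟨f, hf⟩ := exists_aeval_gen_eq hξ (a / b)
  have h1 : σ (a / b) * a = -b := by
    apply hι
    have h := key f
    rw [hf, div_mul_cancel₀ _ hb, hab, hιY, ← hσ] at h
    rw [map_neg, h, ← hf]
    congr 2
    exact (aeval_algHom_apply σ.toAlgHom _ f).symm
  field_simp
  rw [mul_comm, h1]

open Polynomial in
theorem IntermediateField.exists_eq_add_mul_of_mem_adjoin {k L : Type*} [Field k] [Field L]
    [Algebra k L] {ξ : L} (hξ : IsIntegral k ξ) (hξ0 : ξ ≠ 0) (u : k⟮ξ⟯) :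
    ∃ a ∈ k⟮ξ + ξ⁻¹⟯, ∃ b ∈ k⟮ξ + ξ⁻¹⟯, (u : L) = a + b * ξ := by
  obtain ⟨f, rfl⟩ := exists_aeval_gen_eq hξ u
  have ht : ξ + ξ⁻¹ ∈ k⟮ξ + ξ⁻¹⟯ := mem_adjoin_simple_self k _
  have hcoe : ((aeval (AdjoinSimple.gen k ξ) f : k⟮ξ⟯) : L) = aeval ξ f :=
    (aeval_algHom_apply k⟮ξ⟯.val _ f).symm
  rw [hcoe]
  clear hcoe
  induction f using Polynomial.induction_on' with
  | add p q hp hq =>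
    obtain ⟨a, ha, b, hb, h⟩ := hp
    obtain ⟨a', ha', b', hb', h'⟩ := hq
    refine ⟨a + a', add_mem ha ha', b + b', add_mem hb hb', ?_⟩
    rw [map_add, h, h']; ring
  | monomial n c =>
    induction n with
    | zero => exact ⟨algebraMap k L c, algebraMap_mem _ c, 0, zero_mem _, by simp⟩
    | succ n ih =>
      obtain ⟨a, ha, b, hb, h⟩ := ih
      refine ⟨-b, neg_mem hb, a + b * (ξ + ξ⁻¹), add_mem ha (mul_mem hb ht), ?_⟩
      rw [aeval_monomial] at h ⊢
      rw [pow_succ, ← mul_assoc, h]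
      field_simp
      ring

theorem IntermediateField.adjoin_add_inv_le {k L : Type*} [Field k] [Field L]
    [Algebra k L] (ξ : L) : k⟮ξ + ξ⁻¹⟯ ≤ k⟮ξ⟯ := by
  rw [adjoin_simple_le_iff]
  exact add_mem (mem_adjoin_simple_self k ξ) (inv_mem (mem_adjoin_simple_self k ξ))

theorem IntermediateField.apply_eq_self_of_mem_adjoin_add_inv {k L : Type*} [Field k] [Field L]
    [Algebra k L] {ξ : L} {σ : k⟮ξ⟯ ≃ₐ[k] k⟮ξ⟯}
    (hσ : σ (AdjoinSimple.gen k ξ) = (AdjoinSimple.gen k ξ)⁻¹) {u : k⟮ξ⟯}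
    (hu : (u : L) ∈ k⟮ξ + ξ⁻¹⟯) : σ u = u := by
  let i := inclusion (adjoin_add_inv_le (k := k) ξ)
  have h : σ.toAlgHom.comp i = i := by
    refine adjoin_algHom_ext k fun x hx => ?_
    obtain rfl : x = ξ + ξ⁻¹ := hx
    have h1 : i ⟨ξ + ξ⁻¹, mem_adjoin_simple_self k _⟩ =
        AdjoinSimple.gen k ξ + (AdjoinSimple.gen k ξ)⁻¹ := Subtype.ext rfl
    change σ (i ⟨ξ + ξ⁻¹, mem_adjoin_simple_self k _⟩) = i ⟨ξ + ξ⁻¹, mem_adjoin_simple_self k _⟩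
    rw [h1, map_add, map_inv₀, hσ, inv_inv, add_comm]
  exact DFunLike.congr_fun h ⟨(u : L), hu⟩

theorem IntermediateField.mem_adjoin_add_inv_of_apply_eq_self {k L : Type*} [Field k] [Field L]
    [Algebra k L] {ξ : L} (hξ : IsIntegral k ξ) (hξ0 : ξ ≠ 0) (hξ1 : ξ ≠ ξ⁻¹)
    {σ : k⟮ξ⟯ ≃ₐ[k] k⟮ξ⟯} (hσ : σ (AdjoinSimple.gen k ξ) = (AdjoinSimple.gen k ξ)⁻¹)
    {u : k⟮ξ⟯} (hu : σ u = u) : (u : L) ∈ k⟮ξ + ξ⁻¹⟯ := by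
  obtain ⟨a, ha, b, hb, hab⟩ := exists_eq_add_mul_of_mem_adjoin hξ hξ0 u
  let a' : k⟮ξ⟯ := ⟨a, adjoin_add_inv_le ξ ha⟩
  let b' : k⟮ξ⟯ := ⟨b, adjoin_add_inv_le ξ hb⟩
  have h1 : u = a' + b' * AdjoinSimple.gen k ξ := Subtype.ext hab
  have ha' : σ a' = a' := apply_eq_self_of_mem_adjoin_add_inv hσ ha
  have hb' : σ b' = b' := apply_eq_self_of_mem_adjoin_add_inv hσ hb
  have h2 : u = a' + b' * (AdjoinSimple.gen k ξ)⁻¹ := by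
    rw [← hu]
    conv_lhs => rw [h1, map_add, map_mul, ha', hb', hσ]
  have h3 : (u : L) = a + b * ξ⁻¹ := congrArg Subtype.val h2
  have h4 : b * (ξ - ξ⁻¹) = 0 := by linear_combination h3 - hab
  have hb0 : b = 0 := (mul_eq_zero.1 h4).resolve_right (sub_ne_zero.2 hξ1)
  rw [hab, hb0, zero_mul, add_zero]
  exact ha

theorem IntermediateField.apply_apply_eq_self_of_apply_gen {k L : Type*} [Field k] [Field L]
    [Algebra k L] {ξ : L} (hξ : IsIntegral k ξ) {σ : k⟮ξ⟯ ≃ₐ[k] k⟮ξ⟯}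
    (hσ : σ (AdjoinSimple.gen k ξ) = (AdjoinSimple.gen k ξ)⁻¹) (u : k⟮ξ⟯) : σ (σ u) = u := by
  obtain ⟨f, rfl⟩ := exists_aeval_gen_eq hξ u
  rw [← Polynomial.aeval_algHom_apply, ← Polynomial.aeval_algHom_apply, hσ, map_inv₀, hσ, inv_inv]

theorem IntermediateField.exists_mul_eq_neg_one_iff {k L : Type*} [Field k] [Field L]
    [Algebra k L] {ξ : L} (hξ : IsIntegral k ξ) (hk : (2 : L) ≠ 0) {m : ℕ}
    (hξm : ξ ^ 2 ^ (m + 1) = -1)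
    {σ : k⟮ξ⟯ ≃ₐ[k] k⟮ξ⟯} (hσ : σ (AdjoinSimple.gen k ξ) = (AdjoinSimple.gen k ξ)⁻¹) :
    (∃ c, c * σ c = -1) ↔ ∃ x y : k⟮ξ + ξ⁻¹⟯, x ^ 2 + y ^ 2 = -1 := by
  have hξ0 : ξ ≠ 0 := by
    rintro rfl
    rw [zero_pow (by positivity)] at hξm
    exact one_ne_zero (neg_eq_zero.1 hξm.symm)
  have hξ1 : ξ ≠ ξ⁻¹ := fun h => by
    have h1 : ξ ^ 2 = 1 := by rw [sq]; nth_rewrite 2 [h]; exact mul_inv_cancel₀ hξ0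
    rw [pow_succ', pow_mul, h1, one_pow] at hξm
    exact hk (by linear_combination hξm)
  have hk' : (2 : k⟮ξ⟯) ≠ 0 := fun h => hk (congrArg Subtype.val h)
  let i : k⟮ξ⟯ := AdjoinSimple.gen k ξ ^ 2 ^ m
  have hi : i ^ 2 = -1 := by
    rw [← pow_mul, ← pow_succ]
    exact Subtype.ext hξm
  have hi0 : i ≠ 0 := fun h => by simp [h] at hi
  have hσi : σ i = -i := by
    rw [map_pow, hσ, inv_pow]
    change i⁻¹ = -i
    exact inv_eq_of_mul_eq_one_right (by linear_combination -hi)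
  have hσσ := apply_apply_eq_self_of_apply_gen hξ hσ
  constructor
  · rintro ⟨c, hc⟩
    let x := (c + σ c) / 2
    let y := (c - σ c) / (2 * i)
    have hx : σ x = x := by simp only [x, map_div₀, map_add, hσσ, map_ofNat, add_comm]
    have hy : σ y = y := by
      simp only [y, map_div₀, map_sub, hσσ, map_ofNat, map_mul, hσi]
      field_simp
      ring
    have hxy : x ^ 2 + y ^ 2 = -1 := by
      simp only [x, y, div_pow, mul_pow, hi]
      field_simp
      linear_combination 4 * hc
    refine ⟨⟨x, mem_adjoin_add_inv_of_apply_eq_self hξ hξ0 hξ1 hσ hx⟩,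
      ⟨y, mem_adjoin_add_inv_of_apply_eq_self hξ hξ0 hξ1 hσ hy⟩, Subtype.ext ?_⟩
    have hL : (x : L) ^ 2 + (y : L) ^ 2 = -1 := congrArg (Subtype.val (p := (· ∈ k⟮ξ⟯))) hxy
    exact hL
  · rintro ⟨x, y, hxy⟩
    let x' := inclusion (adjoin_add_inv_le (k := k) ξ) x
    let y' := inclusion (adjoin_add_inv_le (k := k) ξ) y
    have hx : σ x' = x' := apply_eq_self_of_mem_adjoin_add_inv hσ x.2
    have hy : σ y' = y' := apply_eq_self_of_mem_adjoin_add_inv hσ y.2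
    have hxy' : x' ^ 2 + y' ^ 2 = -1 := by
      simp only [x', y', ← map_pow, ← map_add, hxy, map_neg, map_one]
    refine ⟨x' + i * y', ?_⟩
    rw [map_add, map_mul, hx, hy, hσi]
    linear_combination hxy' - y' ^ 2 * hi

theorem Module.End.exists_injective_quaternionGroup {k V : Type*} [Field k] [AddCommGroup V]
    [Module k V] [FiniteDimensional k V] [Nontrivial V] (hk : (2 : k) ≠ 0) {m : ℕ}
    {X Y : Module.End k V} (hX : X ^ 2 ^ m = -1) (hY : Y * Y = -1) (hXY : X * Y * X = Y) :
    ∃ φ : QuaternionGroup (2 ^ m) →* Matrix.GeneralLinearGroup (Fin (Module.finrank k V)) k,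
      Function.Injective φ := by
  have h1 : (-1 : Module.End k V) ≠ 1 := fun h => by
    obtain ⟨v, hv⟩ := exists_ne (0 : V)
    have h2 : (2 : k) • v = 0 := by
      rw [two_smul]
      nth_rewrite 1 [← Module.End.one_apply (R := k) v]
      rw [← h]
      simp
    exact (smul_eq_zero.1 h2).elim hk hv
  have hX' : X ^ 2 ^ (m + 1) = 1 := by rw [pow_succ, pow_mul, hX, neg_one_sq]
  let x : (Module.End k V)ˣ := Units.ofPowEqOne X _ hX' (by positivity)
  let y : (Module.End k V)ˣ := Units.ofPowEqOne Y 4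
    (by rw [show 4 = 2 * 2 from rfl, pow_mul, sq Y, hY, neg_one_sq]) (by norm_num)
  have hxv : (x : Module.End k V) = X := rfl
  have hyv : (y : Module.End k V) = Y := rfl
  have hx : orderOf x = 2 * 2 ^ m := by
    rw [← pow_succ']
    refine orderOf_eq_prime_pow (fun h => h1 ?_) (Units.ext ?_)
    · rw [← hX, ← hxv, ← Units.val_pow_eq_pow_val, h, Units.val_one]
    · rw [Units.val_pow_eq_pow_val, hxv, hX', Units.val_one]
  obtain ⟨f, hf⟩ := QuaternionGroup.exists_injective_monoidHom hx (Y := y)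
    (Units.ext (by rw [Units.val_pow_eq_pow_val, Units.val_pow_eq_pow_val, hxv, hyv, hX, sq, hY]))
    (Units.ext (by rw [Units.val_mul, Units.val_mul, hxv, hyv, hXY]))
  let e := Units.mapEquiv (LinearMap.toMatrixAlgEquiv (Module.finBasis k V)).toMulEquiv
  exact ⟨e.toMonoidHom.comp f, e.injective.comp hf⟩

theorem QuaternionGroup.exists_injective_generalLinearGroup_two_mul {k L : Type*} [Field k]
    [Field L] [Algebra k L] (hk : (2 : k) ≠ 0) {m : ℕ} {ξ : L} (hξ : IsIntegral k ξ)
    (hξm : ξ ^ 2 ^ m = -1) :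
    ∃ φ : QuaternionGroup (2 ^ m) →*
      Matrix.GeneralLinearGroup (Fin (2 * Module.finrank k k⟮ξ⟯)) k, Function.Injective φ := by
  have := adjoin.finiteDimensional hξ
  let z := AdjoinSimple.gen k ξ
  have hz : z ^ 2 ^ m = -1 := Subtype.ext hξm
  have hz0 : z ≠ 0 := by
    intro h
    rw [h, zero_pow (by positivity)] at hz
    exact one_ne_zero (neg_eq_zero.1 hz.symm)
  let X : Module.End k (k⟮ξ⟯ × k⟮ξ⟯) := (LinearMap.mulLeft k z).prodMap (LinearMap.mulLeft k z⁻¹)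
  let Y : Module.End k (k⟮ξ⟯ × k⟮ξ⟯) :=
    (-LinearMap.snd k k⟮ξ⟯ k⟮ξ⟯).prod (LinearMap.fst k k⟮ξ⟯ k⟮ξ⟯)
  have hXn : ∀ (n : ℕ) (w : k⟮ξ⟯ × k⟮ξ⟯), (X ^ n) w = (z ^ n * w.1, z⁻¹ ^ n * w.2) := fun n => by
    induction n with
    | zero => simp
    | succ n ih =>
      intro w
      rw [pow_succ, Module.End.mul_apply, ih]
      simp [X, pow_succ, mul_assoc]
  have h := Module.End.exists_injective_quaternionGroup (m := m) (X := X) (Y := Y) hk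
    (LinearMap.ext fun w => by
      rw [hXn, inv_pow, hz, inv_neg, inv_one, LinearMap.neg_apply, Module.End.one_apply]
      simp [Prod.ext_iff])
    (LinearMap.ext fun w => by simp [Y, Prod.ext_iff])
    (LinearMap.ext fun w => by simp [X, Y, hz0])
  rwa [Module.finrank_prod, ← two_mul] at h

theorem QuaternionGroup.exists_injective_generalLinearGroup {k L : Type*} [Field k]
    [Field L] [Algebra k L] (hk : (2 : k) ≠ 0) {m : ℕ} {ξ : L} (hξ : IsIntegral k ξ)
    (hξm : ξ ^ 2 ^ m = -1) {σ : k⟮ξ⟯ ≃ₐ[k] k⟮ξ⟯}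
    (hσ : σ (AdjoinSimple.gen k ξ) = (AdjoinSimple.gen k ξ)⁻¹) {c : k⟮ξ⟯} (hc : c * σ c = -1) :
    ∃ φ : QuaternionGroup (2 ^ m) →*
      Matrix.GeneralLinearGroup (Fin (Module.finrank k k⟮ξ⟯)) k, Function.Injective φ := by
  have := adjoin.finiteDimensional hξ
  have hz : AdjoinSimple.gen k ξ ^ 2 ^ m = -1 := Subtype.ext hξm
  have hz0 : AdjoinSimple.gen k ξ ≠ 0 := by
    intro h
    rw [h, zero_pow (by positivity)] at hz
    exact one_ne_zero (neg_eq_zero.1 hz.symm)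
  refine Module.End.exists_injective_quaternionGroup
    (X := LinearMap.mulLeft k (AdjoinSimple.gen k ξ))
    (Y := LinearMap.mulLeft k c ∘ₗ σ.toLinearMap) hk ?_ ?_ ?_
  · rw [LinearMap.pow_mulLeft, hz]
    exact LinearMap.ext fun u => by simp
  · refine LinearMap.ext fun u => ?_
    simp [apply_apply_eq_self_of_apply_gen hξ hσ]
    linear_combination u * hc
  · refine LinearMap.ext fun u => ?_
    simp [hσ]
    field_simp

theorem QuaternionGroup.finrank_le_and_exists_algEquiv {k L : Type*} [Field k]
    [Field L] [Algebra k L] [IsAlgClosed L] {m : ℕ} {ξ : L} (hξ : IsIntegral k ξ)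
    (hξm : IsPrimitiveRoot ξ (2 ^ (m + 1))) {e : ℕ}
    {φ : QuaternionGroup (2 ^ m) →* Matrix.GeneralLinearGroup (Fin e) k}
    (hφ : Function.Injective φ) :
    Module.finrank k k⟮ξ⟯ ≤ e ∧ (e < 2 * Module.finrank k k⟮ξ⟯ →
      ∃ σ : k⟮ξ⟯ ≃ₐ[k] k⟮ξ⟯, σ (AdjoinSimple.gen k ξ) = (AdjoinSimple.gen k ξ)⁻¹ ∧
        ∃ c, c * σ c = -1) := by
  let ρ : QuaternionGroup (2 ^ m) →* Module.End k (Fin e → k) :=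
    (Matrix.toLinAlgEquiv' : Matrix (Fin e) (Fin e) k ≃ₐ[k] _).toMulEquiv.toMonoidHom.comp
      ((Units.coeHom _).comp φ)
  have hρ : Function.Injective ρ :=
    Matrix.toLinAlgEquiv'.injective.comp (Units.val_injective.comp hφ)
  let x : QuaternionGroup (2 ^ m) := a 1
  let y : QuaternionGroup (2 ^ m) := xa 0
  have ho : orderOf x = 2 ^ (m + 1) := by rw [orderOf_a_one, pow_succ']
  have hx : x ^ 2 ^ m ≠ 1 := fun h => by
    have := (Nat.pow_dvd_pow_iff_le_right (by norm_num)).1 (ho ▸ orderOf_dvd_of_pow_eq_one h)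
    omega
  have hy : y * y = x ^ 2 ^ m := by simp [x, y]
  have hyx : y * x = x⁻¹ * y := by
    rw [eq_inv_mul_iff_mul_eq]; simp [x, y]
  obtain ⟨j, ⟨i, rfl⟩, v, hv, hjv⟩ :=
    Module.End.exists_odd_aeval_minpoly_apply_eq_zero (k := k) hξm (M := ρ x)
    (by rw [← map_pow, ← map_one ρ]; exact hρ.ne hx)
    (by rw [← map_pow, ← ho, pow_orderOf_eq_one, map_one])
  obtain ⟨ι, hι, hιX⟩ := Module.End.exists_injective_of_aeval_minpoly hξ hv hjv
  have hfr : Module.finrank k (Fin e → k) = e := Module.finrank_fin_fun k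
  refine ⟨hfr ▸ LinearMap.finrank_le_finrank_of_injective hι, fun hlt => ?_⟩
  refine exists_algEquiv_mul_eq_neg_one_of_finrank_lt hξ (hξm.ne_zero (by positivity))
    (Xi := ρ (x ^ (2 * i + 1))⁻¹) (Y := ρ y) ?_ ?_ hι hιX (fun u => ?_) (hfr.symm ▸ hlt)
  · rw [← map_pow, ← map_mul, inv_mul_cancel, map_one]
  · rw [← map_pow, ← map_mul, ← map_mul, ← inv_pow]
    exact congrArg ρ (SemiconjBy.pow_right (show SemiconjBy y x x⁻¹ from hyx) _)
  · have hy2 : y * y = (x ^ (2 * i + 1)) ^ 2 ^ m := by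
      rw [← pow_mul, add_mul, pow_add, mul_right_comm, ← pow_succ', pow_mul, ← ho,
        pow_orderOf_eq_one, one_pow, one_mul, one_mul, hy]
    have h := LinearMap.aeval_apply_of_semiconj hιX (Polynomial.X ^ 2 ^ m) u
    have hz : AdjoinSimple.gen k ξ ^ 2 ^ m = -1 := Subtype.ext hξm.pow_two_pow_eq_neg_one
    rw [map_pow, Polynomial.aeval_X, map_pow, Polynomial.aeval_X, hz, neg_one_mul, map_neg] at h
    rw [← h, ← Module.End.mul_apply, ← map_mul, hy2, map_pow, map_pow]

theorem minFaithfulDim_eq_of_mulEquiv {k G H : Type*} [Field k] [Group G] [Group H] (e : G ≃* H) :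
    minFaithfulDim k H = minFaithfulDim k G := by
  unfold minFaithfulDim
  congr 1
  ext d
  exact ⟨fun ⟨φ, hφ⟩ => ⟨φ.comp e.toMonoidHom, hφ.comp e.injective⟩,
    fun ⟨φ, hφ⟩ => ⟨φ.comp e.symm.toMonoidHom, hφ.comp e.symm.injective⟩⟩

theorem minFaithfulDim_eq_of_forall_le {k G : Type*} [Field k] [Group G] {d : ℕ}
    (h : ∃ φ : G →* Matrix.GeneralLinearGroup (Fin d) k, Function.Injective φ)
    (hle : ∀ e, ∀ φ : G →* Matrix.GeneralLinearGroup (Fin e) k, Function.Injective φ → d ≤ e) :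
    minFaithfulDim k G = d :=
  le_antisymm (Nat.sInf_le h) (le_csInf ⟨d, h⟩ fun e ⟨φ, hφ⟩ => hle e φ hφ)

theorem stmt6 (p r q s : ℕ) (hp : p.Prime) (hodd : p ≠ 2) (hr : 1 ≤ r)
    (hq : q = p ^ r) (hq4 : q % 4 = 3) (hs : s = padicValNat 2 (q + 1) + 1)
    (k : Type*) [Field k] (hchar : ringChar k ≠ 2)
    (ξ : AlgebraicClosure k) (hξ : IsPrimitiveRoot ξ (2 ^ (s - 1)))
    (F : Type*) [Field F] [Fintype F] (hF : Fintype.card F = q)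
    (P : Sylow 2 (Matrix.SpecialLinearGroup (Fin 2) F)) :
    (¬ (∃ σ : k⟮ξ⟯ ≃ₐ[k] k⟮ξ⟯, σ (AdjoinSimple.gen k ξ) = (AdjoinSimple.gen k ξ)⁻¹) →
      minFaithfulDim k ↥P = 2 * Module.finrank k (IntermediateField.adjoin k {ξ})) ∧
    ((∃ σ : k⟮ξ⟯ ≃ₐ[k] k⟮ξ⟯, σ (AdjoinSimple.gen k ξ) = (AdjoinSimple.gen k ξ)⁻¹) →
      ((∃ x y : (IntermediateField.adjoin k {ξ + ξ⁻¹} :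
            IntermediateField k (AlgebraicClosure k)), x ^ 2 + y ^ 2 = -1) →
        minFaithfulDim k ↥P = Module.finrank k (IntermediateField.adjoin k {ξ})) ∧
      (¬ (∃ x y : (IntermediateField.adjoin k {ξ + ξ⁻¹} :
            IntermediateField k (AlgebraicClosure k)), x ^ 2 + y ^ 2 = -1) →
        minFaithfulDim k ↥P = 2 * Module.finrank k (IntermediateField.adjoin k {ξ}))) := by
  have hq1 : q + 1 ≠ 0 := by omega
  have h2t : 2 ≤ padicValNat 2 (q + 1) :=
    (padicValNat_dvd_iff_le hq1).1 (by norm_num; omega)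
  obtain ⟨m, hm⟩ := Nat.exists_eq_add_of_le' h2t
  obtain ⟨E⟩ := Sylow.nonempty_mulEquiv_quaternionGroup (F := F) (m := m + 1) (by rw [hF, hq4])
    (by rw [hF, hm]) P
  have hP : minFaithfulDim k ↥P = minFaithfulDim k (QuaternionGroup (2 ^ (m + 1))) :=
    minFaithfulDim_eq_of_mulEquiv E
  rw [hP]
  have hk : (2 : k) ≠ 0 := Ring.two_ne_zero hchar
  have hL : (2 : AlgebraicClosure k) ≠ 0 := by
    rw [← map_ofNat (algebraMap k (AlgebraicClosure k)) 2]
    exact (map_ne_zero _).2 hk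
  have hξ' : IsPrimitiveRoot ξ (2 ^ (m + 1 + 1)) := by
    rwa [hs, hm, Nat.add_sub_cancel] at hξ
  have hξm := hξ'.pow_two_pow_eq_neg_one
  have hi : IsIntegral k ξ := Algebra.IsIntegral.isIntegral ξ
  have hub := QuaternionGroup.exists_injective_generalLinearGroup_two_mul hk hi hξm
  refine ⟨fun hno => ?_, fun ⟨σ, hσ⟩ => ⟨fun hxy => ?_, fun hxy => ?_⟩⟩
  · refine minFaithfulDim_eq_of_forall_le hub fun e φ hφ => ?_
    by_contra! hlt
    obtain ⟨σ, hσ, -⟩ := (QuaternionGroup.finrank_le_and_exists_algEquiv hi hξ' hφ).2 hlt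
    exact hno ⟨σ, hσ⟩
  · obtain ⟨c, hc⟩ := (exists_mul_eq_neg_one_iff hi hL hξm hσ).2 hxy
    exact minFaithfulDim_eq_of_forall_le
      (QuaternionGroup.exists_injective_generalLinearGroup hk hi hξm hσ hc)
      fun e φ hφ => (QuaternionGroup.finrank_le_and_exists_algEquiv hi hξ' hφ).1
  · refine minFaithfulDim_eq_of_forall_le hub fun e φ hφ => ?_
    by_contra! hlt
    obtain ⟨τ, hτ, hc⟩ := (QuaternionGroup.finrank_le_and_exists_algEquiv hi hξ' hφ).2 hlt
    exact hxy ((exists_mul_eq_neg_one_iff hi hL hξm hτ).1 hc)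
end

section
/- Let p be an odd prime, q = p^r with q ≡ 1 (mod 4), and s = v₂(q−1). Let k be a field of characteristic ≠ 2 which contains a primitive 2^s-th root of unity. Then for every n ≥ 2 and every Sylow 2-subgroup P of SL_n(F_q), the minimal faithful representation dimension of P over k equals n−1 if n is odd, and equals n if n is even. -/
section Involutions

variable {k V E Γ : Type*} [Field k] [AddCommGroup V] [Module k V] [CommGroup E] [Group Γ]

/-- A representation of a finite commutative group of exponent two is diagonalisable. -/
theorem span_signed_fixed_eq_top [Finite E] (h2 : (2 : k) ≠ 0) (hE : ∀ x : E, x * x = 1)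
    (ψ : E →* (V →ₗ[k] V)) :
    Submodule.span k {v : V | ∀ e, ψ e v = v ∨ ψ e v = -v} = ⊤ := by
  classical
  have := Fintype.ofFinite E
  suffices h : ∀ T : Finset E,
      Submodule.span k {v : V | ∀ e ∈ T, ψ e v = v ∨ ψ e v = -v} = ⊤ by
    simpa using h Finset.univ
  intro T
  induction T using Finset.induction_on with
  | empty => simp
  | insert a T _ ih =>
    rw [eq_top_iff, ← ih, Submodule.span_le]
    intro v hv
    have hcomm : ∀ e v, ψ e (ψ a v) = ψ a (ψ e v) := fun e v => by
      rw [← Module.End.mul_apply, ← Module.End.mul_apply, ← map_mul, ← map_mul, mul_comm]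
    have hsq : ψ a (ψ a v) = v := by
      rw [← Module.End.mul_apply, ← map_mul, hE, map_one, Module.End.one_apply]
    have hv' : v = (2 : k)⁻¹ • (v + ψ a v) + (2 : k)⁻¹ • (v - ψ a v) := by
      rw [← smul_add, add_add_sub_cancel, ← two_smul k v, smul_smul, inv_mul_cancel₀ h2, one_smul]
    rw [hv']
    refine Submodule.add_mem _ (Submodule.smul_mem _ _ (Submodule.subset_span ?_))
      (Submodule.smul_mem _ _ (Submodule.subset_span ?_))
    · intro e he
      rcases Finset.mem_insert.1 he with rfl | he
      · left; rw [map_add, hsq, add_comm]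
      · rcases hv e he with h | h
        · left; rw [map_add, hcomm, h]
        · right; rw [map_add, hcomm, h, map_neg, neg_add]
    · intro e he
      rcases Finset.mem_insert.1 he with rfl | he
      · right; rw [map_sub, hsq, neg_sub]
      · rcases hv e he with h | h
        · left; rw [map_sub, hcomm, h]
        · right; rw [map_sub, hcomm, h, map_neg, neg_sub, neg_sub_neg]

theorem exists_basis_signed_fixed [Finite E] [FiniteDimensional k V] (h2 : (2 : k) ≠ 0)
    (hE : ∀ x : E, x * x = 1) (ψ : E →* (V →ₗ[k] V)) {d : ℕ} (hd : Module.finrank k V = d) :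
    ∃ b : Module.Basis (Fin d) k V, ∀ e j, ψ e (b j) = b j ∨ ψ e (b j) = -b j := by
  have hs := (span_signed_fixed_eq_top h2 hE ψ).ge
  let b := Module.Basis.ofSpan hs
  have := Module.Finite.finite_basis b
  have := Fintype.ofFinite
    ↑((linearIndepOn_empty k (id : V → V)).extend
      (Set.empty_subset {v : V | ∀ e, ψ e v = v ∨ ψ e v = -v}))
  refine ⟨b.reindex (Fintype.equivFinOfCardEq
    ((Module.finrank_eq_card_basis b).symm.trans hd)), fun e j => ?_⟩
  rw [Module.Basis.reindex_apply]
  exact Module.Basis.ofSpan_subset hs (Set.mem_range_self _) e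

open Classical in
theorem signs_injective {d : ℕ} (b : Module.Basis (Fin d) k V) (ψ : E →* (V →ₗ[k] V))
    (hψ : Function.Injective ψ) (hb : ∀ e j, ψ e (b j) = b j ∨ ψ e (b j) = -b j) :
    Function.Injective fun (e : E) (j : Fin d) => decide (ψ e (b j) = b j) := by
  intro x y hxy
  refine hψ (b.ext fun j => ?_)
  have h := congrFun hxy j
  rw [decide_eq_decide] at h
  by_cases hx : ψ x (b j) = b j
  · rw [hx, h.1 hx]
  · rw [(hb x j).resolve_left hx, (hb y j).resolve_left (mt h.2 hx)]

/-- The rank of an elementary abelian 2-group is at most the dimension of any faithful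
representation in characteristic different from two. -/
theorem rank_le_finrank [FiniteDimensional k V] (h2 : (2 : k) ≠ 0)
    (hE : ∀ x : E, x * x = 1) {m : ℕ} (hcard : Nat.card E = 2 ^ m)
    (ψ : E →* (V →ₗ[k] V)) (hψ : Function.Injective ψ) : m ≤ Module.finrank k V := by
  have : Finite E := Nat.finite_of_card_ne_zero (by rw [hcard]; positivity)
  obtain ⟨b, hb⟩ := exists_basis_signed_fixed h2 hE ψ rfl
  have h := Nat.card_le_card_of_injective _ (signs_injective b ψ hψ hb)
  rw [hcard] at h
  simpa [Nat.pow_le_pow_iff_right] using h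

/-- If `E` is an elementary abelian 2-subgroup of odd rank of `Γ`, normalised by an element `w`
which squares into the centraliser of `E`, and every element of `E` fixed by `w` is a commutator
of `w` with an element centralising `E`, then the dimension of a faithful representation of `Γ`
exceeds the rank of `E`. -/
theorem finrank_ne_rank [FiniteDimensional k V] (h2 : (2 : k) ≠ 0)
    (hE : ∀ x : E, x * x = 1) {m : ℕ} (hcard : Nat.card E = 2 ^ m) (hm : Odd m)
    (ι : E →* Γ) (hι : Function.Injective ι) (φ : Γ →* (V →ₗ[k] V)) (hφ : Function.Injective φ)
    (w : Γ) (hw : ∀ x, ∃ y, w * ι x = ι y * w) (hw2 : ∀ x, Commute (w * w) (ι x))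
    (hfix : ∀ x, Commute w (ι x) → ∃ t, (∀ y, Commute t (ι y)) ∧ ι x * (w * t) = t * w) :
    Module.finrank k V ≠ m := by
  classical
  intro hd
  have : Finite E := Nat.finite_of_card_ne_zero (by rw [hcard]; positivity)
  obtain ⟨b, hb⟩ := exists_basis_signed_fixed h2 hE (φ.comp ι) hd
  have hinj := signs_injective b (φ.comp ι) (hφ.comp hι) hb
  have hbij : Function.Bijective
      fun (e : E) (j : Fin m) => decide ((φ.comp ι) e (b j) = b j) := by
    rw [Nat.bijective_iff_injective_and_card]
    exact ⟨hinj, by simp [hcard]⟩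
  simp only [MonoidHom.comp_apply] at hb hinj hbij
  have hneg : ∀ v : V, v = -v → v = 0 := fun v hv => by
    have : (2 : k) • v = 0 := by rw [two_smul]; nth_rewrite 2 [hv]; exact add_neg_cancel v
    exact (smul_eq_zero.1 this).resolve_left h2
  have hmul : ∀ (x y : Γ) v, φ (x * y) v = φ x (φ y v) := fun x y v => by
    rw [map_mul, Module.End.mul_apply]
  have hφinj : ∀ x : Γ, Function.Injective (φ x) := fun x u v huv => by
    have := congrArg (φ x⁻¹) huv
    simpa only [← hmul, inv_mul_cancel, map_one, Module.End.one_apply] using this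
  choose t ht using fun j : Fin m => hbij.2 fun i => decide (i ≠ j)
  have ht1 : ∀ i j, i ≠ j → φ (ι (t j)) (b i) = b i := fun i j hij => by
    have h := congrFun (ht j) i
    simp only [decide_eq_decide] at h
    exact h.2 hij
  have ht2 : ∀ j, φ (ι (t j)) (b j) = -b j := fun j => by
    have h := congrFun (ht j) j
    simp only [decide_eq_decide] at h
    exact (hb (t j) j).resolve_left fun h' => h.1 h' rfl
  have htinj : Function.Injective t := fun i j hij => by
    by_contra hne
    have h1 := ht1 i j hne
    rw [← hij, ht2] at h1
    exact b.ne_zero i (hneg _ h1.symm)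
  have heig : ∀ j v, φ (ι (t j)) v = -v → ∃ α : k, v = α • b j := fun j v hv => by
    refine ⟨b.repr v j, b.ext_elem fun i => ?_⟩
    by_cases hij : i = j
    · subst hij; simp
    · have hc : (b.coord i) ∘ₗ φ (ι (t j)) = b.coord i := b.ext fun l => by
        by_cases hl : l = j
        · subst hl
          simp [ht2, Ne.symm hij]
        · simp [ht1 l j hl]
      have h := LinearMap.congr_fun hc v
      rw [LinearMap.comp_apply, hv, map_neg, Module.Basis.coord_apply] at h
      have h0 : b.repr v i = 0 := by
        have : (2 : k) * b.repr v i = 0 := by linear_combination -h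
        exact (mul_eq_zero.1 this).resolve_left h2
      simp [h0, Ne.symm hij]
  have hperm : ∀ j, ∃ i, w * ι (t j) = ι (t i) * w := fun j => by
    obtain ⟨y, hy⟩ := hw (t j)
    have hline : ∀ i, φ (ι y) (b i) = -b i → ∃ α : k, b i = α • φ w (b j) := fun i hi => by
      obtain ⟨α, hα⟩ := heig j (φ w⁻¹ (b i)) (by
        refine hφinj w ?_
        rw [← hmul, hy, hmul, ← hmul w, mul_inv_cancel, map_one, Module.End.one_apply, hi,
          map_neg, ← hmul, mul_inv_cancel, map_one, Module.End.one_apply])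
      refine ⟨α, ?_⟩
      rw [← map_smul, ← hα, ← hmul, mul_inv_cancel, map_one, Module.End.one_apply]
    have hex : ∃ i, φ (ι y) (b i) = -b i := by
      by_contra! hne
      have hy1 : φ (ι y) = φ 1 := b.ext fun i => by
        rw [(hb y i).resolve_right (hne i), map_one, Module.End.one_apply]
      rw [hφ hy1, one_mul, mul_eq_left] at hy
      have h := ht2 j
      rw [hy, map_one, Module.End.one_apply] at h
      exact b.ne_zero j (hneg _ h)
    obtain ⟨i, hi⟩ := hex
    refine ⟨i, ?_⟩
    rw [hy]
    congr 2
    refine hinj (funext fun l => ?_)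
    simp only [decide_eq_decide]
    by_cases hl : l = i
    · subst hl; rw [hi, ht2]
    · rw [ht1 l i hl]
      refine iff_of_true ((hb y l).resolve_right fun hl' => ?_) rfl
      obtain ⟨α, hα⟩ := hline i hi
      obtain ⟨β, hβ⟩ := hline l hl'
      have hrel : β • b i = α • b l := by rw [hα, hβ, smul_comm]
      have h := congrArg (b.coord i) hrel
      have hβ0 : β = 0 := by simpa [Finsupp.single_apply, hl] using h
      rw [hβ0, zero_smul] at hβ
      exact b.ne_zero l hβ
  choose σ hσ using hperm
  have hσ2 : Function.Involutive σ := fun j => by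
    apply htinj
    apply hι
    have h1 : w * w * ι (t j) = ι (t (σ (σ j))) * (w * w) := by
      rw [mul_assoc, hσ, ← mul_assoc, hσ, mul_assoc]
    rw [(hw2 (t j)).eq] at h1
    exact (mul_right_cancel h1).symm
  obtain ⟨j, hj⟩ := Equiv.Perm.exists_fixed_point_of_prime (p := 2) (n := 1)
    (by rw [Fintype.card_fin]; exact hm.not_two_dvd_nat) (σ := hσ2.toPerm)
    (by ext i; simp [pow_two, hσ2 i])
  replace hj : σ j = j := hj
  have hcomm : Commute w (ι (t j)) := by
    have := hσ j
    rwa [hj] at this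
  obtain ⟨x, hx, hxw⟩ := hfix (t j) hcomm
  have hscal : ∀ g : Γ, Commute g (ι (t j)) → ∃ α : k, φ g (b j) = α • b j := fun g hg =>
    heig j _ (by rw [← hmul, ← hg.eq, hmul, ht2, map_neg])
  obtain ⟨α, hα⟩ := hscal x (hx _)
  obtain ⟨β, hβ⟩ := hscal w hcomm
  have h := congrArg (fun f => φ f (b j)) hxw
  simp only [hmul, hα, hβ, map_smul, ht2] at h
  rw [smul_neg, smul_neg, smul_comm] at h
  have h0 := hneg _ h.symm
  rw [← hα, ← map_smul, ← hβ] at h0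
  exact b.ne_zero j (hφinj w (hφinj x (by simpa using h0)))

end Involutions

section Sylow

/-- A `p`-group embedding in a finite group embeds in every subgroup of the same `p`-adic order. -/
theorem IsPGroup.exists_injective_of_factorization_eq {p : ℕ} [Fact p.Prime]
    {Q G Γ : Type*} [Group Q] [Group G] [Group Γ] [Finite G] [Finite Γ]
    (hQ : IsPGroup p Q) (g : Q →* Γ) (hg : Function.Injective g)
    (f : G →* Γ) (hf : Function.Injective f)
    (hcard : (Nat.card G).factorization p = (Nat.card Γ).factorization p) :
    ∃ h : Q →* G, Function.Injective h := by
  obtain ⟨S⟩ : Nonempty (Sylow p G) := inferInstance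
  let eS := S.1.equivMapOfInjective f hf
  let T : Sylow p Γ := Sylow.ofCard (S.1.map f) (by
    rw [← Nat.card_congr eS.toEquiv, ← hcard]; exact S.card_eq_multiplicity)
  obtain ⟨R, hR⟩ := (hQ.of_equiv (MonoidHom.ofInjective hg)).exists_le_sylow
  let e : R ≃* S.1 := (Sylow.equiv R T).trans eS.symm
  refine ⟨S.1.subtype.comp (e.toMonoidHom.comp ((Subgroup.inclusion hR).comp g.rangeRestrict)), ?_⟩
  exact S.1.subtype_injective.comp (e.injective.comp
    ((Subgroup.inclusion_injective hR).comp fun x y hxy => hg (congrArg Subtype.val hxy)))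

theorem IsPGroup.exists_injective_sylow {p : ℕ} [Fact p.Prime]
    {Q Γ : Type*} [Group Q] [Group Γ] [Finite Γ]
    (hQ : IsPGroup p Q) (g : Q →* Γ) (hg : Function.Injective g) (P : Sylow p Γ) :
    ∃ h : Q →* P, Function.Injective h := by
  obtain ⟨R, hR⟩ := (hQ.of_equiv (MonoidHom.ofInjective hg)).exists_le_sylow
  refine ⟨(Sylow.equiv R P).toMonoidHom.comp
    ((Subgroup.inclusion hR).comp g.rangeRestrict), ?_⟩
  exact (Sylow.equiv R P).injective.comp
    ((Subgroup.inclusion_injective hR).comp fun x y hxy => hg (congrArg Subtype.val hxy))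

end Sylow

section Orders

theorem padicValNat_two_pow_sub_one {q : ℕ} (hq : q % 4 = 1) (hq1 : 1 < q)
    {n : ℕ} (hn : n ≠ 0) :
    padicValNat 2 (q ^ n - 1) = padicValNat 2 (q - 1) + padicValNat 2 n := by
  have h := Int.two_pow_sub_pow' (x := q) (y := 1) n (by omega) (by omega)
  have hqn : 1 < q ^ n := Nat.one_lt_pow hn (by omega)
  have e1 : (q : ℤ) ^ n - 1 ^ n = ((q ^ n - 1 : ℕ) : ℤ) := by
    rw [Nat.cast_sub hqn.le]; simp
  have e2 : (q : ℤ) - 1 = ((q - 1 : ℕ) : ℤ) := by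
    rw [Nat.cast_sub (by omega)]; simp
  rw [e1, e2, show (2 : ℤ) = ((2 : ℕ) : ℤ) from rfl, Int.natCast_emultiplicity,
    Int.natCast_emultiplicity, Int.natCast_emultiplicity, ← padicValNat_eq_emultiplicity (by omega),
    ← padicValNat_eq_emultiplicity (by omega), ← padicValNat_eq_emultiplicity hn] at h
  exact_mod_cast h

variable {F : Type*} [Field F] [Fintype F]

theorem padicValNat_two_card_GL (hq : Fintype.card F % 4 = 1) (n : ℕ) :
    padicValNat 2 (Nat.card (GL (Fin n) F)) =
      padicValNat 2 (Fintype.card F - 1) * n + padicValNat 2 n.factorial := by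
  set q := Fintype.card F with hqdef
  have hq1 : 1 < q := Fintype.one_lt_card
  have hcard : Nat.card (GL (Fin n) F) =
      (∏ i ∈ Finset.range n, q ^ i) * ∏ i ∈ Finset.range n, (q ^ (i + 1) - 1) := by
    rw [Matrix.card_GL_field, Finset.prod_range, ← Finset.prod_range_reflect, Finset.prod_range,
      ← Finset.prod_mul_distrib]
    refine Finset.prod_congr rfl fun i _ => ?_
    rw [Nat.mul_sub, mul_one, ← pow_add]
    congr 2
    omega
  have hqodd : ¬ 2 ∣ q := by omega
  have hpos : ∀ i, q ^ (i + 1) - 1 ≠ 0 := fun i => by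
    exact Nat.sub_ne_zero_of_lt (Nat.one_lt_pow (Nat.succ_ne_zero i) hq1)
  have hpow : padicValNat 2 (∏ i ∈ Finset.range n, q ^ i) = 0 := by
    rw [Finset.prod_pow_eq_pow_sum]
    exact padicValNat.eq_zero_of_not_dvd fun h => hqodd (Nat.prime_two.dvd_of_dvd_pow h)
  rw [hcard, padicValNat.mul (by rw [Finset.prod_ne_zero_iff]; intros; positivity)
    (by rw [Finset.prod_ne_zero_iff]; exact fun i _ => hpos i), hpow, zero_add]
  clear hcard hpow
  induction n with
  | zero => simp
  | succ n ih =>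
    rw [Finset.prod_range_succ, padicValNat.mul
      (by rw [Finset.prod_ne_zero_iff]; exact fun i _ => hpos i) (hpos n), ih,
      padicValNat_two_pow_sub_one hq hq1 n.succ_ne_zero, Nat.factorial_succ,
      padicValNat.mul n.succ_ne_zero n.factorial_ne_zero]
    ring

theorem card_SL_mul {n : ℕ} (hn : n ≠ 0) :
    Nat.card (Matrix.SpecialLinearGroup (Fin n) F) * (Fintype.card F - 1) =
      Nat.card (GL (Fin n) F) := by
  classical
  have : NeZero n := ⟨hn⟩
  have hsurj : Function.Surjective (Matrix.GeneralLinearGroup.det : GL (Fin n) F →* Fˣ) := by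
    intro u
    refine ⟨Matrix.GeneralLinearGroup.mkOfDetNeZero (Matrix.diagonal (Pi.mulSingle 0 (u : F)))
      (by simp [Matrix.det_diagonal]), Units.ext ?_⟩
    simp [Matrix.GeneralLinearGroup.mkOfDetNeZero, Matrix.det_diagonal]
  have hker : (Matrix.SpecialLinearGroup.toGL (n := Fin n) (R := F)).range =
      Matrix.GeneralLinearGroup.det.ker := by
    ext g
    constructor
    · rintro ⟨h, rfl⟩
      exact Units.ext h.2
    · intro hg
      exact ⟨⟨g, congrArg Units.val hg⟩, Units.ext rfl⟩
  rw [Nat.card_congr (MonoidHom.ofInjective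
    (Matrix.SpecialLinearGroup.toGL_injective (n := Fin n) (R := F))).toEquiv, hker,
    ← Subgroup.card_mul_index Matrix.GeneralLinearGroup.det.ker, Subgroup.index_ker,
    MonoidHom.range_eq_top.2 hsurj, Subgroup.card_top, Nat.card_units,
    Nat.card_eq_fintype_card (α := F)]

theorem padicValNat_two_card_SL (hq : Fintype.card F % 4 = 1) {m : ℕ} (hm : Even m) :
    padicValNat 2 (Nat.card (Matrix.SpecialLinearGroup (Fin (m + 1)) F)) =
      padicValNat 2 (Nat.card (GL (Fin m) F)) := by
  classical
  have hq1 : 1 < Fintype.card F := Fintype.one_lt_card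
  have h := congrArg (padicValNat 2) (card_SL_mul (F := F) m.succ_ne_zero)
  rw [padicValNat.mul Nat.card_pos.ne' (by omega), padicValNat_two_card_GL hq,
    Nat.factorial_succ, padicValNat.mul m.succ_ne_zero m.factorial_ne_zero,
    padicValNat.eq_zero_of_not_dvd (n := m + 1) (by have := hm.two_dvd; omega)] at h
  rw [padicValNat_two_card_GL hq]
  linarith

end Orders

section Embeddings

variable {R : Type*} [CommRing R]

/-- The embedding `g ↦ diag(g, (det g)⁻¹)` of `GL_m` in `SL_{m+1}`. -/
def glToSLSucc (m : ℕ) : GL (Fin m) R →* Matrix.SpecialLinearGroup (Fin (m + 1)) R where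
  toFun g := ⟨(Matrix.fromBlocks g.1 0 0 (Matrix.diagonal fun _ : Fin 1 =>
    ((Matrix.GeneralLinearGroup.det g)⁻¹ : Rˣ).1)).submatrix
      finSumFinEquiv.symm finSumFinEquiv.symm, by
    rw [Matrix.det_submatrix_equiv_self, Matrix.det_fromBlocks_zero₂₁, Matrix.det_diagonal]
    simpa using (Matrix.GeneralLinearGroup.det g).mul_inv⟩
  map_one' := by
    apply Subtype.ext
    simp
  map_mul' g h := by
    refine Subtype.ext (Eq.trans ?_ (Matrix.submatrix_mul_equiv _ _ _ _ _).symm)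
    rw [Matrix.fromBlocks_multiply, Matrix.diagonal_mul_diagonal]
    simp [mul_comm]

theorem glToSLSucc_injective (m : ℕ) : Function.Injective (glToSLSucc (R := R) m) := by
  intro g h hgh
  refine Units.ext (Matrix.ext fun i j => ?_)
  have := congrFun (congrFun (congrArg Subtype.val hgh) (Fin.castAdd 1 i)) (Fin.castAdd 1 j)
  change Matrix.fromBlocks _ _ _ _ (finSumFinEquiv.symm _) (finSumFinEquiv.symm _) =
    Matrix.fromBlocks _ _ _ _ (finSumFinEquiv.symm _) (finSumFinEquiv.symm _) at this
  simpa only [finSumFinEquiv_symm_apply_castAdd, Matrix.fromBlocks_apply₁₁] using this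

end Embeddings

section Monomial

variable {C R ι : Type*} [Fintype ι] [DecidableEq ι] [CommGroup C] [CommRing R]

/-- The wreath product of `C` by the symmetric group on `ι`. -/
abbrev PermWreath (C ι : Type*) [CommGroup C] : Type _ :=
  (ι → C) ⋊[(mulAutArrow : Equiv.Perm ι →* MulAut (ι → C))] Equiv.Perm ι

theorem mulAutArrow_apply_eq {C ι : Type*} [CommGroup C] (σ : Equiv.Perm ι) (a : ι → C) (i : ι) :
    mulAutArrow σ a i = a (σ.symm i) := rfl

/-- The monomial representation of the wreath product attached to a character of the base. -/
def monomialHom (χ : C →* R) : PermWreath C ι →* GL ι R :=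
  MonoidHom.toHomUnits
    { toFun := fun x => Matrix.of fun i j => if i = x.right j then χ (x.left i) else 0
      map_one' := by
        ext i j
        simp [Matrix.one_apply]
      map_mul' := fun x y => by
        ext i j
        rw [Matrix.mul_apply, Finset.sum_eq_single (y.right j)
          (fun l _ hl => by simp [hl]) (by simp)]
        simp only [Matrix.of_apply, SemidirectProduct.mul_right, Equiv.Perm.mul_apply,
          SemidirectProduct.mul_left, Pi.mul_apply, map_mul, if_true]
        split_ifs with h
        · rw [mulAutArrow_apply_eq, h, Equiv.symm_apply_apply]
        · rw [zero_mul] }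

theorem monomialHom_apply (χ : C →* R) (x : PermWreath C ι) (i j : ι) :
    (monomialHom χ x).1 i j = if i = x.right j then χ (x.left i) else 0 := rfl

theorem monomialHom_injective [Nontrivial R] (χ : C →* R) (hχ : Function.Injective χ) :
    Function.Injective (monomialHom (ι := ι) χ) := by
  intro x y hxy
  have h : ∀ i j, (if i = x.right j then χ (x.left i) else 0) =
      if i = y.right j then χ (y.left i) else 0 := fun i j => by
    rw [← monomialHom_apply, ← monomialHom_apply, hxy]
  have hne : ∀ c, χ c ≠ 0 := fun c => (Group.isUnit c |>.map χ).ne_zero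
  have hr : x.right = y.right := by
    ext j
    by_contra hj
    have := h (x.right j) j
    rw [if_pos rfl, if_neg hj] at this
    exact hne _ this
  refine SemidirectProduct.ext (funext fun i => hχ ?_) hr
  have := h i (x.right.symm i)
  simpa [← hr] using this

theorem det_monomialHom_inl (χ : C →* R) (a : ι → C) :
    (monomialHom χ (SemidirectProduct.inl a)).1.det = ∏ i, χ (a i) := by
  rw [← Matrix.det_diagonal]
  congr 1

end Monomial

section RootsOfUnity

theorem two_le_padicValNat_sub_one {q : ℕ} (hq : q % 4 = 1) (hq1 : 1 < q) :
    2 ≤ padicValNat 2 (q - 1) :=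
  (padicValNat_dvd_iff_le (by omega)).1 (by omega)

theorem exists_isPrimitiveRoot_two_pow (F : Type*) [Field F] [Fintype F] :
    ∃ ζ : F, IsPrimitiveRoot ζ (2 ^ padicValNat 2 (Fintype.card F - 1)) := by
  classical
  obtain ⟨g, hg⟩ := IsCyclic.exists_ofOrder_eq_natCard (α := Fˣ)
  obtain ⟨c, hc⟩ := pow_padicValNat_dvd (p := 2) (n := Fintype.card F - 1)
  have hg' : orderOf g = Fintype.card F - 1 := by
    rw [hg, Nat.card_units, Nat.card_eq_fintype_card]
  have h := (IsPrimitiveRoot.orderOf g).pow (orderOf_pos g)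
    (a := c) (b := 2 ^ padicValNat 2 (Fintype.card F - 1)) (by rw [hg', mul_comm]; exact hc)
  exact ⟨_, h.map_of_injective (f := Units.coeHom F) Units.val_injective⟩

end RootsOfUnity

section UpperBound

theorem padicValNat_two_card_permWreath {C : Type*} [CommGroup C] [Finite C] {s : ℕ}
    (hC : Nat.card C = 2 ^ s) (m : ℕ) :
    padicValNat 2 (Nat.card (PermWreath C (Fin m))) = s * m + padicValNat 2 m.factorial := by
  rw [SemidirectProduct.card, Nat.card_fun, Nat.card_perm, Nat.card_fin, hC,
    padicValNat.mul (by positivity) m.factorial_ne_zero, ← pow_mul, padicValNat.prime_pow]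

/-- A 2-group embedding in `GL_m(F)`, where `|F| ≡ 1 mod 4`, embeds in `GL_m(k)` for each field
`k` with as many roots of unity of 2-power order. -/
theorem IsPGroup.exists_injective_GL {F k Q : Type*} [Field F] [Fintype F] [Field k] [Group Q]
    (hq : Fintype.card F % 4 = 1)
    (hk : ∃ ζ : k, IsPrimitiveRoot ζ (2 ^ padicValNat 2 (Fintype.card F - 1)))
    (hQ : IsPGroup 2 Q) {m : ℕ} (g : Q →* GL (Fin m) F) (hg : Function.Injective g) :
    ∃ h : Q →* GL (Fin m) k, Function.Injective h := by
  classical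
  set N := 2 ^ padicValNat 2 (Fintype.card F - 1) with hN
  have : NeZero N := ⟨by positivity⟩
  obtain ⟨ζ, hζ⟩ := hk
  obtain ⟨ξ, hξ⟩ := exists_isPrimitiveRoot_two_pow F
  let C := rootsOfUnity N F
  have hC : Nat.card C = N := hξ.card_rootsOfUnity
  let χF : C →* F := (Units.coeHom F).comp (Subgroup.subtype C)
  have hχF : Function.Injective χF := Units.val_injective.comp (Subgroup.subtype_injective C)
  let e : C ≃* rootsOfUnity N k :=
    mulEquivOfCyclicCardEq (hC.trans hζ.card_rootsOfUnity.symm)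
  let χk : C →* k := ((Units.coeHom k).comp (Subgroup.subtype _)).comp e.toMonoidHom
  have hχk : Function.Injective χk :=
    (Units.val_injective.comp (Subgroup.subtype_injective _)).comp e.injective
  have : Finite (PermWreath C (Fin m)) := Finite.of_equiv _ SemidirectProduct.equivProd.symm
  obtain ⟨h, hh⟩ := hQ.exists_injective_of_factorization_eq g hg
    (monomialHom (ι := Fin m) χF) (monomialHom_injective χF hχF) (by
      rw [Nat.factorization_def _ Nat.prime_two, Nat.factorization_def _ Nat.prime_two,
        padicValNat_two_card_permWreath hC, padicValNat_two_card_GL hq])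
  exact ⟨(monomialHom χk).comp h, (monomialHom_injective χk hχk).comp hh⟩

end UpperBound

section LowerBound

/-- The product of the coordinates. -/
def piProdHom (ι B : Type*) [Fintype ι] [CommGroup B] : (ι → B) →* B where
  toFun a := ∏ i, a i
  map_one' := by simp
  map_mul' a b := Finset.prod_mul_distrib

theorem piProdHom_apply {ι B : Type*} [Fintype ι] [CommGroup B] (a : ι → B) :
    piProdHom ι B a = ∏ i, a i := rfl

theorem card_ker_piProdHom {B : Type*} [CommGroup B] [Finite B] {n : ℕ} (hn : n ≠ 0) :
    Nat.card (piProdHom (Fin n) B).ker = Nat.card B ^ (n - 1) := by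
  have : NeZero n := ⟨hn⟩
  have hsurj : Function.Surjective (piProdHom (Fin n) B) := fun b =>
    ⟨Pi.mulSingle 0 b, by rw [piProdHom_apply, Finset.prod_pi_mulSingle']; simp⟩
  have h := (piProdHom (Fin n) B).ker.card_mul_index
  rw [Subgroup.index_ker, MonoidHom.range_eq_top.2 hsurj, Subgroup.card_top, Nat.card_fun,
    Nat.card_fin] at h
  obtain ⟨m, rfl⟩ := Nat.exists_eq_succ_of_ne_zero hn
  rw [pow_succ] at h
  exact Nat.eq_of_mul_eq_mul_right Nat.card_pos h

variable {F : Type*} [Field F] {n : ℕ} (C : Subgroup Fˣ)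

/-- The determinant of monomial matrices with entries in `C`. -/
def monomialDet (n : ℕ) : PermWreath C (Fin n) →* Fˣ :=
  Matrix.GeneralLinearGroup.det.comp (monomialHom ((Units.coeHom F).comp C.subtype))

theorem monomialDet_inl (a : Fin n → C) :
    monomialDet C n (SemidirectProduct.inl a) = ((piProdHom _ _ a : C) : Fˣ) := by
  refine Units.ext ((det_monomialHom_inl _ a).trans ?_)
  rw [piProdHom_apply, Subgroup.val_finsetProd, Units.coe_prod]
  rfl

/-- Monomial matrices of determinant one whose permutation is a power of the order reversal. -/
def revMonomial (n : ℕ) : Subgroup (PermWreath C (Fin n)) :=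
  (monomialDet C n).ker ⊓ (Subgroup.zpowers (Fin.revPerm (n := n))).comap
    SemidirectProduct.rightHom

theorem revPerm_mul_self : Fin.revPerm (n := n) * Fin.revPerm = 1 := by
  ext i; simp

theorem isPGroup_revMonomial (hC : IsPGroup 2 C) : IsPGroup 2 (revMonomial C n) := by
  refine IsPGroup.to_le ?_ inf_le_right
  refine IsPGroup.comap_of_ker_isPGroup ?_ _ ?_
  · rintro ⟨x, i, rfl⟩
    refine ⟨1, Subtype.ext ?_⟩
    simp only [SubmonoidClass.coe_pow, OneMemClass.coe_one]
    rw [pow_one, pow_two, ← (Commute.refl _).mul_zpow, revPerm_mul_self, one_zpow]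
  · rw [← SemidirectProduct.range_inl_eq_ker_rightHom]
    refine IsPGroup.of_surjective ?_ _ (MonoidHom.rangeRestrict_surjective _)
    intro a
    choose e he using fun i => hC (a i)
    refine ⟨∑ i, e i, funext fun i => ?_⟩
    obtain ⟨c, hc⟩ := pow_dvd_pow 2 (Finset.single_le_sum (f := e) (fun _ _ => Nat.zero_le _)
      (Finset.mem_univ i))
    rw [Pi.pow_apply, hc, pow_mul, he, one_pow, Pi.one_apply]

/-- The inclusion of the monomial group in the special linear group. -/
def revMonomialToSL (n : ℕ) : revMonomial C n →* Matrix.SpecialLinearGroup (Fin n) F where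
  toFun x := ⟨(monomialHom ((Units.coeHom F).comp C.subtype) x.1).1, congrArg Units.val x.2.1⟩
  map_one' := Subtype.ext (by simp)
  map_mul' _ _ := Subtype.ext (by simp; rfl)

theorem revMonomialToSL_injective : Function.Injective (revMonomialToSL C n) := fun _ _ hxy =>
  Subtype.ext (monomialHom_injective _
    (Units.val_injective.comp C.subtype_injective) (Units.ext (congrArg Subtype.val hxy)))

variable {C} {B : Subgroup Fˣ}

/-- The diagonal matrices of determinant one with entries in `B`. -/
def diagToRevMonomial (hBC : B ≤ C) (n : ℕ) : (piProdHom (Fin n) B).ker →* revMonomial C n :=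
  ((SemidirectProduct.inl.comp ((Subgroup.inclusion hBC).compLeft (Fin n))).comp
    (Subgroup.subtype _)).codRestrict _ fun a => by
      refine ⟨?_, ?_⟩
      · change monomialDet C n (SemidirectProduct.inl _) = 1
        rw [monomialDet_inl, ← OneMemClass.coe_one B, ← a.2]
        simp [piProdHom_apply]
      · exact Subgroup.mem_comap.2 (by simp)

theorem diagToRevMonomial_injective (hBC : B ≤ C) :
    Function.Injective (diagToRevMonomial hBC n) := by
  intro x y hxy
  refine Subtype.ext (funext fun i => Subgroup.inclusion_injective hBC ?_)
  exact congrFun (SemidirectProduct.inl_injective (congrArg Subtype.val hxy)) i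

theorem diagToRevMonomial_coe (hBC : B ≤ C) (x : (piProdHom (Fin n) B).ker) :
    (diagToRevMonomial hBC n x : PermWreath C (Fin n)) =
      SemidirectProduct.inl fun i => Subgroup.inclusion hBC (x.1 i) := rfl

theorem isPGroup_rootsOfUnity_two_pow (R : Type*) [CommRing R] (s : ℕ) :
    IsPGroup 2 (rootsOfUnity (2 ^ s) R) := fun x => ⟨s, Subtype.ext x.2⟩

theorem eq_one_or_eq_neg_one_of_mem_rootsOfUnity_two {u : Fˣ} (hu : u ∈ rootsOfUnity 2 F) :
    u = 1 ∨ u = -1 := by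
  rw [mem_rootsOfUnity, Units.ext_iff, Units.val_pow_eq_pow_val, Units.val_one,
    sq_eq_one_iff] at hu
  exact hu.imp (fun h => Units.ext h) fun h => Units.ext h

theorem card_ker_piProdHom_rootsOfUnity_two (hF : (2 : F) ≠ 0) (hn : n ≠ 0) :
    Nat.card (piProdHom (Fin n) (rootsOfUnity 2 F)).ker = 2 ^ (n - 1) := by
  have : Finite (rootsOfUnity 2 F) := inferInstance
  rw [card_ker_piProdHom hn, (IsPrimitiveRoot.neg_one (ringChar F) fun h => hF ?_).card_rootsOfUnity]
  have := ringChar.Nat.cast_ringChar (R := F)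
  rw [h] at this
  exact_mod_cast this

theorem sq_eq_one_of_ker_piProdHom (x : (piProdHom (Fin n) (rootsOfUnity 2 F)).ker) :
    x * x = 1 := by
  refine Subtype.ext (funext fun i => Subtype.ext ?_)
  have := (x.1 i).2
  rw [mem_rootsOfUnity, pow_two] at this
  exact this

theorem revMonomial_rank_le {k V : Type*} [Field k] [AddCommGroup V] [Module k V]
    [FiniteDimensional k V] (h2 : (2 : k) ≠ 0) (hF : (2 : F) ≠ 0) (hn : n ≠ 0)
    (hBC : rootsOfUnity 2 F ≤ C)
    (φ : revMonomial C n →* (V →ₗ[k] V)) (hφ : Function.Injective φ) :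
    n - 1 ≤ Module.finrank k V :=
  rank_le_finrank h2 sq_eq_one_of_ker_piProdHom (card_ker_piProdHom_rootsOfUnity_two hF hn)
    (φ.comp (diagToRevMonomial hBC n)) (hφ.comp (diagToRevMonomial_injective hBC))

/-- In even dimension, each symmetric sign vector of product one is of the form `a / a ∘ rev` for
some `a` of product one, as soon as there is a square root of `-1`. -/
theorem exists_div_rev_eq (hBC : rootsOfUnity 2 F ≤ C) {j : C} (hj : (j : Fˣ) * j = -1)
    (hn : Even n) (hn0 : n ≠ 0) (ε : Fin n → rootsOfUnity 2 F) (hε : ∀ i, ε i.rev = ε i) :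
    ∃ a : Fin n → C, piProdHom _ _ a = 1 ∧
      ∀ i, Subgroup.inclusion hBC (ε i) * a i.rev = a i := by
  have : NeZero n := ⟨hn0⟩
  have hrev : ∀ i : Fin n, i.rev ≠ i := fun i h => by
    have := congrArg Fin.val h
    rw [Fin.val_rev] at this
    obtain ⟨m, rfl⟩ := hn
    omega
  let a₀ : Fin n → rootsOfUnity 2 F := fun i => if i < i.rev then ε i else 1
  have hsq : ∀ x : rootsOfUnity 2 F, x * x = 1 := fun x => by
    rw [← pow_two]; exact Subtype.ext x.2
  have ha₀ : ∀ i, ε i * a₀ i.rev = a₀ i := fun i => by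
    simp only [a₀, Fin.rev_rev, hε]
    rcases lt_trichotomy i i.rev with h | h | h
    · simp [h, h.not_gt]
    · exact absurd h.symm (hrev i)
    · simp [h, h.not_gt, hsq]
  have ha₁ : ∀ i, Subgroup.inclusion hBC (ε i) * Subgroup.inclusion hBC (a₀ i.rev) =
      Subgroup.inclusion hBC (a₀ i) := fun i => by rw [← map_mul, ha₀]
  rcases eq_one_or_eq_neg_one_of_mem_rootsOfUnity_two (piProdHom _ _ a₀).2 with h | h
  · refine ⟨fun i => Subgroup.inclusion hBC (a₀ i), ?_, ha₁⟩
    have h' : piProdHom _ _ a₀ = 1 := Subtype.ext h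
    rw [piProdHom_apply, ← map_prod, ← piProdHom_apply, h', map_one]
  · let c : Fin n → C := Pi.mulSingle 0 j * Pi.mulSingle (Fin.rev 0) j
    have hc : ∀ i, c i.rev = c i := fun i => by
      simp only [c, Pi.mul_apply, Pi.mulSingle_apply, Fin.rev_eq_iff (i := i), Fin.rev_rev]
      rw [mul_comm]
    refine ⟨fun i => Subgroup.inclusion hBC (a₀ i) * c i, ?_, fun i => ?_⟩
    · have hc1 : ∏ i, c i = j * j := by
        simp [c, Finset.prod_mul_distrib]
      rw [piProdHom_apply, Finset.prod_mul_distrib, hc1, ← map_prod, ← piProdHom_apply]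
      refine Subtype.ext ?_
      simp [h, hj]
    · simp only [hc]
      rw [← mul_assoc, ha₁]

theorem revMonomial_finrank_ne {k V : Type*} [Field k] [AddCommGroup V] [Module k V]
    [FiniteDimensional k V] (h2 : (2 : k) ≠ 0) (hF : (2 : F) ≠ 0) (hn : Even n) (hn0 : n ≠ 0)
    (hBC : rootsOfUnity 2 F ≤ C) {j : C} (hj : (j : Fˣ) * j = -1)
    (φ : revMonomial C n →* (V →ₗ[k] V)) (hφ : Function.Injective φ) :
    Module.finrank k V ≠ n - 1 := by
  have : NeZero n := ⟨hn0⟩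
  let r : PermWreath C (Fin n) := SemidirectProduct.inr Fin.revPerm
  have hr : r * r = 1 := by rw [← map_mul, revPerm_mul_self, map_one]
  have hra : ∀ a : Fin n → C, r * SemidirectProduct.inl a =
      SemidirectProduct.inl (fun i => a i.rev) * r := fun a => by
    refine SemidirectProduct.ext (funext fun i => ?_) ?_
    · simp only [r, SemidirectProduct.mul_left, SemidirectProduct.left_inl,
        SemidirectProduct.left_inr, SemidirectProduct.right_inr, SemidirectProduct.right_inl,
        map_one, Pi.mul_apply, Pi.one_apply, one_mul, mul_one, mulAutArrow_apply_eq,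
        Fin.revPerm_symm, Fin.revPerm_apply]
    · simp [r]
  have hδ : monomialDet C n r ∈ rootsOfUnity 2 F := by
    rw [mem_rootsOfUnity, pow_two, ← map_mul, hr, map_one]
  let b : Fin n → C := Pi.mulSingle 0 ⟨(monomialDet C n r)⁻¹, hBC (inv_mem hδ)⟩
  let w : revMonomial C n := ⟨SemidirectProduct.inl b * r, by
    refine ⟨?_, ?_⟩
    · change monomialDet C n _ = 1
      rw [map_mul, monomialDet_inl, piProdHom_apply]
      simp [b]
    · exact Subgroup.mem_comap.2 (by simp [r])⟩
  have hdiag := diagToRevMonomial_coe hBC (n := n)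
  refine finrank_ne_rank h2 sq_eq_one_of_ker_piProdHom
    (card_ker_piProdHom_rootsOfUnity_two hF hn0) (Nat.Even.sub_odd (by omega) hn odd_one)
    (diagToRevMonomial hBC n) (diagToRevMonomial_injective hBC) φ hφ w ?_ ?_ ?_
  · intro x
    refine ⟨⟨fun i => x.1 i.rev, ?_⟩, Subtype.ext ?_⟩
    · rw [MonoidHom.mem_ker, piProdHom_apply, ← x.2, piProdHom_apply]
      exact Equiv.prod_comp Fin.revPerm x.1
    · rw [Subgroup.coe_mul, Subgroup.coe_mul, hdiag, hdiag, mul_assoc, hra, ← mul_assoc,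
        ← mul_assoc, ← map_mul, ← map_mul, mul_comm]
  · intro x
    refine Subtype.ext ?_
    have hww : (w * w).1 = SemidirectProduct.inl (b * fun i => b i.rev) := by
      change SemidirectProduct.inl b * r * (SemidirectProduct.inl b * r) = _
      rw [mul_assoc, ← mul_assoc r, hra, mul_assoc, hr, mul_one, ← map_mul]
    change (w * w).1 * (diagToRevMonomial hBC n x).1 = (diagToRevMonomial hBC n x).1 * (w * w).1
    rw [hww, hdiag, ← map_mul, ← map_mul, mul_comm]
  · intro x hx
    have hε : ∀ i, x.1 i.rev = x.1 i := fun i => by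
      have h := congrArg Subtype.val hx.eq
      rw [Subgroup.coe_mul, Subgroup.coe_mul, hdiag, mul_assoc, hra, ← mul_assoc, ← mul_assoc,
        mul_left_inj, ← map_mul, ← map_mul, mul_comm] at h
      have h' := congrFun (mul_right_cancel (SemidirectProduct.inl_injective h)) i
      exact Subgroup.inclusion_injective hBC h'
    obtain ⟨a, ha, hxa⟩ := exists_div_rev_eq hBC hj hn hn0 x.1 hε
    refine ⟨⟨SemidirectProduct.inl a, ?_, ?_⟩, fun y => Subtype.ext ?_, Subtype.ext ?_⟩
    · change monomialDet C n _ = 1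
      rw [monomialDet_inl, ha, OneMemClass.coe_one]
    · exact Subgroup.mem_comap.2 (by simp)
    · rw [Subgroup.coe_mul, Subgroup.coe_mul, hdiag, ← map_mul, ← map_mul, mul_comm]
    · rw [Subgroup.coe_mul, Subgroup.coe_mul, Subgroup.coe_mul, hdiag]
      change _ * (SemidirectProduct.inl b * r * SemidirectProduct.inl a) =
        SemidirectProduct.inl a * (SemidirectProduct.inl b * r)
      rw [mul_assoc, hra, ← mul_assoc, ← mul_assoc, ← mul_assoc, ← map_mul, ← map_mul, ← map_mul]
      congr 2
      funext i
      rw [Pi.mul_apply, Pi.mul_apply, Pi.mul_apply, mul_right_comm, hxa]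

theorem le_of_injective_sylow {F k : Type*} [Field F] [Fintype F] [Field k]
    (hq : Fintype.card F % 4 = 1) (h2 : (2 : k) ≠ 0) {n : ℕ} (hn : n ≠ 0)
    (P : Sylow 2 (Matrix.SpecialLinearGroup (Fin n) F)) {d : ℕ} (φ : P →* GL (Fin d) k)
    (hφ : Function.Injective φ) : n - 1 ≤ d ∧ (Even n → n ≤ d) := by
  classical
  have hF : (2 : F) ≠ 0 :=
    Ring.two_ne_zero fun h => by have := FiniteField.even_card_iff_char_two.1 h; omega
  set s := padicValNat 2 (Fintype.card F - 1) with hs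
  have hs2 : 2 ≤ s := two_le_padicValNat_sub_one hq Fintype.one_lt_card
  let C := rootsOfUnity (2 ^ s) F
  have hBC : rootsOfUnity 2 F ≤ C := rootsOfUnity_le_of_dvd (dvd_pow_self 2 (by omega))
  obtain ⟨j, hj⟩ : ∃ j : C, (j : Fˣ) * j = -1 := by
    obtain ⟨u, hu⟩ := FiniteField.isSquare_neg_one_iff.2 (by omega : Fintype.card F % 4 ≠ 3)
    have hu0 : u ≠ 0 := by rintro rfl; simp at hu
    have hu2 : Units.mk0 u hu0 * Units.mk0 u hu0 = -1 := Units.ext hu.symm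
    refine ⟨⟨Units.mk0 u hu0, ?_⟩, hu2⟩
    obtain ⟨c, hc⟩ := pow_dvd_pow 2 hs2
    rw [mem_rootsOfUnity, hc, pow_mul, show 2 ^ 2 = 2 * 2 from rfl, pow_mul _ 2 2,
      pow_two (Units.mk0 u hu0), hu2, neg_one_sq, one_pow]
  obtain ⟨f, hf⟩ := (isPGroup_revMonomial (n := n) C
    (isPGroup_rootsOfUnity_two_pow F s)).exists_injective_sylow _ (revMonomialToSL_injective C) P
  let ψ : revMonomial C n →* ((Fin d → k) →ₗ[k] (Fin d → k)) :=
    (Matrix.toLinAlgEquiv' : Matrix (Fin d) (Fin d) k ≃ₐ[k] _).toMonoidHom.comp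
      ((Units.coeHom _).comp (φ.comp f))
  have hψ : Function.Injective ψ :=
    Matrix.toLinAlgEquiv'.injective.comp (Units.val_injective.comp (hφ.comp hf))
  have h1 := revMonomial_rank_le h2 hF hn hBC ψ hψ
  rw [Module.finrank_fin_fun] at h1
  refine ⟨h1, fun hev => ?_⟩
  have h3 := revMonomial_finrank_ne h2 hF hev hn hBC hj ψ hψ
  rw [Module.finrank_fin_fun] at h3
  omega

end LowerBound

theorem stmt7 (p r q s : ℕ) (hp : p.Prime) (hodd : p ≠ 2) (hr : 1 ≤ r)
    (hq : q = p ^ r) (hq4 : q % 4 = 1) (hs : s = padicValNat 2 (q - 1))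
    (k : Type*) [Field k] (hchar : ringChar k ≠ 2)
    (hroot : ∃ ζ : k, IsPrimitiveRoot ζ (2 ^ s))
    (F : Type*) [Field F] [Fintype F] (hF : Fintype.card F = q)
    (n : ℕ) (hn : 2 ≤ n)
    (P : Sylow 2 (Matrix.SpecialLinearGroup (Fin n) F)) :
    (Odd n → minFaithfulDim k ↥P = n - 1) ∧
    (Even n → minFaithfulDim k ↥P = n) := by
  classical
  rw [← hF] at hq4 hs
  rw [hs] at hroot
  have h2 : (2 : k) ≠ 0 := Ring.two_ne_zero hchar
  have hle {d : ℕ} (φ : P →* GL (Fin d) k) (hφ : Function.Injective φ) :=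
    le_of_injective_sylow hq4 h2 (by omega) P φ hφ
  constructor
  · intro hodd'
    obtain ⟨m, rfl⟩ : ∃ m, n = m + 1 := ⟨n - 1, by omega⟩
    obtain ⟨g, hg⟩ := P.2.exists_injective_of_factorization_eq P.1.subtype
      P.1.subtype_injective (glToSLSucc m) (glToSLSucc_injective m) (by
        rw [Nat.factorization_def _ Nat.prime_two, Nat.factorization_def _ Nat.prime_two,
          padicValNat_two_card_SL hq4 (by simpa [Nat.odd_add_one] using hodd')])
    have hmem := IsPGroup.exists_injective_GL hq4 hroot P.2 g hg
    exact le_antisymm (Nat.sInf_le hmem) (le_csInf ⟨_, hmem⟩ fun d ⟨φ, hφ⟩ => (hle φ hφ).1)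
  · intro heven
    have hmem := IsPGroup.exists_injective_GL hq4 hroot P.2
      (Matrix.SpecialLinearGroup.toGL.comp P.1.subtype)
      (Matrix.SpecialLinearGroup.toGL_injective.comp P.1.subtype_injective)
    exact le_antisymm (Nat.sInf_le hmem)
      (le_csInf ⟨_, hmem⟩ fun d ⟨φ, hφ⟩ => (hle φ hφ).2 heven)
end

section
/- Let k be a field of characteristic ≠ 2, let s > 2 be an integer, and let ε be a primitive 2^s-th root of unity in a fixed algebraic closure of k. Let SD be the semidihedral group of order 2^{s+1}, i.e. the semidirect product C_{2^s} ⋊ C₂ in which the nontrivial element of C₂ acts on the cyclic group C_{2^s} = ⟨x⟩ by x ↦ x^{2^{s−1}−1}. Then the minimal faithful representation dimension of SD over k equals 2·[k(ε−ε⁻¹):k]. -/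
/-- Normal form of the elements of a group generated by `a` and `b`. -/
theorem exists_eq_pow_or_eq_pow_mul {G : Type*} [Group G] {a b : G} {N m : ℕ} (hN : 0 < N)
    (ha : a ^ N = 1) (hb : b ^ 2 = 1) (hab : b * a * b = a ^ m) {g : G}
    (hg : g ∈ Subgroup.closure {a, b}) : ∃ i < N, g = a ^ i ∨ g = a ^ i * b := by
  have hbb : b * b = 1 := by rw [← sq, hb]
  have hbinv : b⁻¹ = b := inv_eq_of_mul_eq_one_left hbb
  have hainv : a⁻¹ = a ^ (N - 1) := by
    refine inv_eq_of_mul_eq_one_left ?_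
    rw [← pow_succ, Nat.sub_add_cancel hN, ha]
  have hcomm (i : ℕ) : b * a ^ i = a ^ (m * i) * b := by
    have h : (b * a * b⁻¹) ^ i = b * a ^ i * b⁻¹ := conj_pow
    rw [hbinv, hab, ← pow_mul] at h
    rw [h, mul_assoc, hbb, mul_one]
  suffices h : ∃ i, g = a ^ i ∨ g = a ^ i * b by
    obtain ⟨i, hi⟩ := h
    exact ⟨i % N, Nat.mod_lt _ hN, by rwa [← pow_mod_orderOf a (i % N),
      Nat.mod_mod_of_dvd _ (orderOf_dvd_of_pow_eq_one ha), pow_mod_orderOf]⟩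
  have hstepa : ∀ g, (∃ i, g = a ^ i ∨ g = a ^ i * b) → ∀ j,
      ∃ i, a ^ j * g = a ^ i ∨ a ^ j * g = a ^ i * b := by
    rintro g ⟨i, rfl | rfl⟩ j
    · exact ⟨j + i, .inl (pow_add ..).symm⟩
    · exact ⟨j + i, .inr (by rw [pow_add, mul_assoc])⟩
  have hstepb : ∀ g, (∃ i, g = a ^ i ∨ g = a ^ i * b) →
      ∃ i, b * g = a ^ i ∨ b * g = a ^ i * b := by
    rintro g ⟨i, rfl | rfl⟩
    · exact ⟨m * i, .inr (hcomm i)⟩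
    · exact ⟨m * i, .inl (by rw [← mul_assoc, hcomm, mul_assoc, hbb, mul_one])⟩
  induction hg using Subgroup.closure_induction_left with
  | one => exact ⟨0, .inl (pow_zero a).symm⟩
  | mul_left c hc g _ ih =>
    rcases hc with rfl | rfl
    · simpa using hstepa g ih 1
    · exact hstepb g ih
  | inv_mul_cancel c hc g _ ih =>
    rcases hc with rfl | rfl
    · rw [hainv]; exact hstepa g ih _
    · rw [hbinv]; exact hstepb g ih

/-- In a group with the relations of the semidihedral group, in which `u` has full order, the
normal form of the identity is unique. -/
theorem semidihedral_normal_form_one {s : ℕ} (hs : 2 < s) {L : Type*} [Group L] {u v : L}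
    (hu : orderOf u = 2 ^ s) (hv : v ^ 2 = 1) (huv : v * u * v = u ^ (2 ^ (s - 1) - 1)) {i : ℕ}
    (hi : i < 2 ^ s) : (u ^ i = 1 → i = 0) ∧ u ^ i * v ≠ 1 := by
  refine ⟨fun h1 => ?_, fun h => ?_⟩
  · by_contra h0
    have := Nat.le_of_dvd (by omega) (orderOf_dvd_of_pow_eq_one h1)
    omega
  · have hm : 4 * 2 ^ (s - 3) = 2 ^ (s - 1) ∧ 8 * 2 ^ (s - 3) = 2 ^ s := by
      obtain ⟨t, rfl⟩ := Nat.exists_eq_add_of_lt hs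
      constructor
      · rw [show 2 + t + 1 - 1 = t + 2 by omega, show 2 + t + 1 - 3 = t by omega]; ring
      · rw [show 2 + t + 1 - 3 = t by omega]; ring
    have hpos : 0 < 2 ^ (s - 3) := by positivity
    have hv' : v = (u ^ i)⁻¹ := eq_inv_of_mul_eq_one_right h
    have hc : Commute v u := by rw [hv']; exact ((Commute.refl u).pow_left i).inv_left
    rw [hc.eq, mul_assoc, ← sq, hv, mul_one] at huv
    have h1 : u ^ (2 ^ (s - 1) - 2) = 1 := by
      have h2 : u ^ (2 ^ (s - 1) - 2) * u = u := by
        rw [← pow_succ, show 2 ^ (s - 1) - 2 + 1 = 2 ^ (s - 1) - 1 by omega, ← huv]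
      simpa using h2
    have := Nat.le_of_dvd (by omega) (orderOf_dvd_of_pow_eq_one h1)
    omega

/-- Two elements of a group `H` which satisfy the relations of the semidihedral group, the first
of them of full order, define an embedding of the semidihedral group. -/
theorem exists_injective_hom_of_semidihedral_relations {s : ℕ} (hs : 2 < s)
    {SD : Type*} [Group SD] {x y : SD} (hx : orderOf x = 2 ^ s) (hy : y ^ 2 = 1)
    (hxy : y * x * y = x ^ (2 ^ (s - 1) - 1)) (hgen : Subgroup.closure {x, y} = ⊤)
    {H : Type*} [Group H] {X Y : H} (hX : orderOf X = 2 ^ s) (hY : Y ^ 2 = 1)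
    (hXY : Y * X * Y = X ^ (2 ^ (s - 1) - 1)) :
    ∃ φ : SD →* H, Function.Injective φ := by
  have hN : 0 < 2 ^ s := by positivity
  have hxN : x ^ 2 ^ s = 1 := hx ▸ pow_orderOf_eq_one x
  have hXN : X ^ 2 ^ s = 1 := hX ▸ pow_orderOf_eq_one X
  let a : SD × H := (x, X)
  let b : SD × H := (y, Y)
  let Γ := Subgroup.closure {a, b}
  let p : Γ →* SD := (MonoidHom.fst SD H).comp Γ.subtype
  let q : Γ →* H := (MonoidHom.snd SD H).comp Γ.subtype
  have hform (g : Γ) : ∃ i < 2 ^ s, (g : SD × H) = a ^ i ∨ (g : SD × H) = a ^ i * b :=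
    exists_eq_pow_or_eq_pow_mul hN (Prod.ext hxN hXN) (Prod.ext hy hY) (Prod.ext hxy hXY) g.2
  have hq : Function.Injective q := by
    rw [injective_iff_map_eq_one]
    intro g hg
    obtain ⟨i, hi, h | h⟩ := hform g
    · have h1 : X ^ i = 1 := by rw [← hg]; exact (congrArg Prod.snd h).symm
      ext1
      rw [h, (semidihedral_normal_form_one hs hX hY hXY hi).1 h1, pow_zero]; rfl
    · exact absurd ((congrArg Prod.snd h).symm.trans hg)
        (semidihedral_normal_form_one hs hX hY hXY hi).2
  have hsurj : Function.Surjective p := by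
    rw [← MonoidHom.range_eq_top, eq_top_iff, ← hgen, Subgroup.closure_le]
    rintro _ (rfl | rfl)
    · exact ⟨⟨a, Subgroup.subset_closure (.inl rfl)⟩, rfl⟩
    · exact ⟨⟨b, Subgroup.subset_closure (.inr rfl)⟩, rfl⟩
  have hp : Function.Injective p := by
    rw [injective_iff_map_eq_one]
    intro g hg
    obtain ⟨i, hi, h | h⟩ := hform g
    · have h1 : x ^ i = 1 := by rw [← hg]; exact (congrArg Prod.fst h).symm
      ext1
      rw [h, (semidihedral_normal_form_one hs hx hy hxy hi).1 h1, pow_zero]; rfl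
    · exact absurd ((congrArg Prod.fst h).symm.trans hg)
        (semidihedral_normal_form_one hs hx hy hxy hi).2
  exact ⟨q.comp (MulEquiv.ofBijective p ⟨hp, hsurj⟩).symm.toMonoidHom,
    hq.comp (MulEquiv.injective _)⟩

open Polynomial in
/-- If `ε ^ N = -1` and `ε - ε⁻¹ = θ` descends to a subfield, then a root `M` of
`t ^ 2 - θ t - 1` in an algebra over the subfield satisfies `M ^ N = -1`. -/
theorem pow_eq_neg_one_of_sq_eq {F K A : Type*} [Field F] [Field K] [Algebra F K] [Ring A]
    [Algebra F A] {N : ℕ} (hN0 : N ≠ 0) (hN : Even N) {ε : K} {θ : F} (hε : ε ^ N = -1)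
    (hε2 : ε ^ 2 ≠ -1)
    (hθ : algebraMap F K θ = ε - ε⁻¹) {M : A} (hM : M ^ 2 = θ • M + 1) : M ^ N = -1 := by
  have hε0 : ε ≠ 0 := by
    rintro rfl
    simp [zero_pow hN0] at hε
  have hdvd : (X ^ 2 - C θ * X - 1 : F[X]) ∣ X ^ N + 1 := by
    rw [← Polynomial.map_dvd_map' (algebraMap F K)]
    have h1 : (X ^ 2 - C θ * X - 1 : F[X]).map (algebraMap F K)
        = (X - C ε) * (X - C (-ε⁻¹)) := by
      have h2 : (C ε * C ε⁻¹ : K[X]) = 1 := by rw [← C_mul, mul_inv_cancel₀ hε0, C_1]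
      simp only [Polynomial.map_sub, Polynomial.map_mul, Polynomial.map_pow, map_X, map_C,
        Polynomial.map_one, hθ, C_sub, C_neg]
      linear_combination h2
    rw [h1]
    refine IsCoprime.mul_dvd (isCoprime_X_sub_C_of_isUnit_sub (IsUnit.mk0 _ fun h => hε2 ?_))
      ?_ ?_
    · field_simp at h
      linear_combination h
    · rw [dvd_iff_isRoot]; simp [hε]
    · rw [dvd_iff_isRoot]; simp [hN.neg_pow, hε, inv_neg]
  obtain ⟨r, hr⟩ := hdvd
  have := congrArg (Polynomial.aeval M) hr
  simp only [map_add, map_mul, map_sub, map_pow, Polynomial.aeval_X, Polynomial.aeval_C, map_one,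
    hM, ← Algebra.smul_def] at this
  rw [show θ • M + 1 - θ • M - 1 = 0 by abel, zero_mul] at this
  exact eq_neg_of_add_eq_zero_left this

/-- Restriction of scalars for square matrices. -/
theorem exists_injective_monoidHom_matrix (k F : Type*) [Field k] [Field F] [Algebra k F]
    [FiniteDimensional k F] (m : ℕ) :
    ∃ Φ : Matrix (Fin m) (Fin m) F →*
      Matrix (Fin (m * Module.finrank k F)) (Fin (m * Module.finrank k F)) k,
      Function.Injective Φ := by
  let b := Module.finBasis k F
  let f₁ := (Algebra.leftMulMatrix b).mapMatrix (m := Fin m)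
  let f₂ := Matrix.compAlgEquiv (Fin m) (Fin (Module.finrank k F)) k k
  let f₃ := Matrix.reindexAlgEquiv k k (finProdFinEquiv (m := m) (n := Module.finrank k F))
  refine ⟨((f₃.toAlgHom.comp f₂.toAlgHom).comp f₁ : _ →* _), ?_⟩
  exact f₃.injective.comp (f₂.injective.comp
    (Matrix.map_injective (Algebra.leftMulMatrix_injective b)))

/-- The companion matrix of `t ^ 2 - (ε - ε⁻¹) t - 1` gives a faithful representation of the
semidihedral group over `k(ε - ε⁻¹)`, hence one over `k` by restriction of scalars. -/
theorem exists_faithful_semidihedral_representation {k K : Type*} [Field k] [Field K] [Algebra k K]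
    (h2 : (2 : k) ≠ 0) {s : ℕ} (hs : 2 < s) {ε : K} (hε : ε ^ 2 ^ (s - 1) = -1)
    (hint : IsIntegral k (ε - ε⁻¹))
    {SD : Type*} [Group SD] {x y : SD} (hx : orderOf x = 2 ^ s) (hy : y ^ 2 = 1)
    (hxy : y * x * y = x ^ (2 ^ (s - 1) - 1)) (hgen : Subgroup.closure {x, y} = ⊤) :
    ∃ φ : SD →* Matrix.GeneralLinearGroup
      (Fin (2 * Module.finrank k (IntermediateField.adjoin k {ε - ε⁻¹}))) k,
      Function.Injective φ := by
  let F := IntermediateField.adjoin k {ε - ε⁻¹}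
  have : FiniteDimensional k F := IntermediateField.adjoin.finiteDimensional hint
  let θ : F := ⟨ε - ε⁻¹, IntermediateField.mem_adjoin_simple_self k _⟩
  have h2F : (2 : F) ≠ 0 := by
    have := (map_ne_zero (algebraMap k F)).mpr h2
    rwa [map_ofNat] at this
  have h2K : (2 : K) ≠ 0 := by
    have := (map_ne_zero (algebraMap k K)).mpr h2
    rwa [map_ofNat] at this
  obtain ⟨t, rfl⟩ := Nat.exists_eq_add_of_lt hs
  rw [show 2 + t + 1 - 1 = t + 2 by omega] at hε hxy
  have hε2 : ε ^ 2 ≠ -1 := by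
    intro h
    have h4 : ε ^ 4 = 1 := by rw [show 4 = 2 * 2 from rfl, pow_mul, h]; norm_num
    rw [show 2 ^ (t + 2) = 4 * 2 ^ t by ring, pow_mul, h4, one_pow] at hε
    exact h2K (by linear_combination hε)
  let M : Matrix (Fin 2) (Fin 2) F := !![0, 1; 1, θ]
  let P : Matrix (Fin 2) (Fin 2) F := !![1, θ; 0, -1]
  have hM : M ^ 2 = θ • M + 1 := by
    rw [sq]
    ext i j
    fin_cases i <;> fin_cases j <;> (simp [M, Matrix.mul_apply, Fin.sum_univ_two]; try ring)
  have hP : P * P = 1 := by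
    ext i j
    fin_cases i <;> fin_cases j <;> simp [P, Matrix.mul_apply, Fin.sum_univ_two]
  have hPM : P * M * P = θ • 1 - M := by
    ext i j
    fin_cases i <;> fin_cases j <;> simp [M, P, Matrix.mul_apply, Fin.sum_univ_two]
  have hMN : M ^ 2 ^ (t + 2) = -1 :=
    pow_eq_neg_one_of_sq_eq (K := K) (by positivity) ⟨2 ^ (t + 1), by ring⟩ hε hε2 (θ := θ) rfl hM
  have hMi : M * (M - θ • 1) = 1 := by
    rw [mul_sub, ← sq, hM]; simp
  have hMi' : (M - θ • 1) * M = 1 := by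
    rw [sub_mul, ← sq, hM]; simp
  let X : (Matrix (Fin 2) (Fin 2) F)ˣ := ⟨M, M - θ • 1, hMi, hMi'⟩
  let Y : (Matrix (Fin 2) (Fin 2) F)ˣ := ⟨P, P, hP, hP⟩
  have hX : orderOf X = 2 ^ (2 + t + 1) := by
    have : Fact (Nat.Prime 2) := ⟨Nat.prime_two⟩
    rw [show 2 + t + 1 = (t + 2) + 1 by omega]
    apply orderOf_eq_prime_pow
    · intro h
      have h' : M ^ 2 ^ (t + 2) = 1 := congrArg Units.val h
      rw [hMN] at h'
      have := congrFun (congrFun h' 0) 0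
      simp only [Matrix.neg_apply, Matrix.one_apply_eq] at this
      exact h2F (by linear_combination -this)
    · ext1
      simp only [Units.val_pow_eq_pow_val, Units.val_one, X]
      rw [pow_succ, pow_mul, hMN]; simp
  have hXY : Y * X * Y = X ^ (2 ^ (t + 2) - 1) := by
    rw [← mul_left_inj X, ← pow_succ, Nat.sub_add_cancel Nat.one_le_two_pow]
    ext1
    change P * M * P * M = M ^ 2 ^ (t + 2)
    rw [hMN, hPM, ← neg_sub, neg_mul, hMi']
  obtain ⟨φ, hφ⟩ := exists_injective_hom_of_semidihedral_relations (X := X) (Y := Y) hs hx hy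
    (by rwa [show 2 + t + 1 - 1 = t + 2 by omega])
    hgen hX (by ext1; simpa [sq, Y] using hP)
    (by rwa [show 2 + t + 1 - 1 = t + 2 by omega])
  obtain ⟨Φ, hΦ⟩ := exists_injective_monoidHom_matrix k F 2
  exact ⟨(Units.map Φ).comp φ, (Units.map_injective hΦ).comp hφ⟩

open Polynomial in
/-- The degree of an irreducible polynomial `p` bounds the dimension of a `T`-stable subspace that
meets the kernel of `p(T)`. -/
theorem natDegree_le_finrank_of_aeval_apply_eq_zero {k V : Type*} [Field k] [AddCommGroup V]
    [Module k V] [FiniteDimensional k V] {T : Module.End k V} {p : k[X]} (hp : Irreducible p)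
    {W : Submodule k V} (hW : ∀ v ∈ W, T v ∈ W) {u : V} (huW : u ∈ W) (hu : u ≠ 0)
    (hpu : aeval T p u = 0) : p.natDegree ≤ Module.finrank k W := by
  have hmem (f : k[X]) : aeval T f u ∈ W := by
    induction f using Polynomial.induction_on' with
    | add f g hf hg => rw [map_add]; exact W.add_mem hf hg
    | monomial n a =>
      rw [aeval_monomial, Module.End.mul_apply, Module.algebraMap_end_apply]
      refine W.smul_mem _ ?_
      induction n with
      | zero => simpa
      | succ n ih => rw [pow_succ', Module.End.mul_apply]; exact hW _ ih
  let L : degreeLT k p.natDegree →ₗ[k] W :=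
    (((LinearMap.applyₗ u).comp (aeval T).toLinearMap).comp (degreeLT k _).subtype).codRestrict W
      fun f => hmem f
  have hL : Function.Injective L := by
    rw [injective_iff_map_eq_zero]
    rintro ⟨f, hf⟩ h
    have hfu : aeval T f u = 0 := congrArg Subtype.val h
    rcases hp.isCoprime_or_dvd f with ⟨a, b, hab⟩ | hdvd
    · refine absurd ?_ hu
      have := congrArg (fun g => aeval T g u) hab
      simpa [hpu, hfu] using this.symm
    · refine Subtype.ext (eq_zero_of_dvd_of_degree_lt hdvd ?_)
      rw [mem_degreeLT] at hf
      rwa [degree_eq_natDegree hp.ne_zero]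
  have := LinearMap.finrank_le_finrank_of_injective hL
  rwa [(degreeLTEquiv k _).finrank_eq, Module.finrank_fin_fun] at this

open Polynomial in
/-- If `f(A)` is not a unit, then neither is `q(A)` for some irreducible factor `q` of `f`. -/
theorem exists_irreducible_dvd_not_isUnit_aeval {k R : Type*} [Field k] [Ring R] [Algebra k R]
    {A : R} {f : k[X]} (hf : f ≠ 0) (h : ¬ IsUnit (aeval A f)) :
    ∃ q, Irreducible q ∧ q ∣ f ∧ ¬ IsUnit (aeval A q) := by
  induction f using WfDvdMonoid.induction_on_irreducible with
  | zero => exact absurd rfl hf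
  | unit f hu => exact absurd (hu.map _) h
  | mul f i hf0 hi ih =>
    by_cases hA : IsUnit (aeval A i)
    · obtain ⟨q, hq, hqf, hqA⟩ := ih hf0 fun h' => h (by rw [map_mul]; exact hA.mul h')
      exact ⟨q, hq, hqf.mul_left i, hqA⟩
    · exact ⟨i, hi, dvd_mul_right .., hA⟩

open Polynomial in
/-- The eigenspace of `B` for the eigenvalue `1` in a representation of the semidihedral group
which does not kill the central involution. -/
theorem natDegree_le_finrank_ker_sub_one {k V : Type*} [Field k] (h2 : (2 : k) ≠ 0)
    [AddCommGroup V] [Module k V] [FiniteDimensional k V] {A B : Module.End k V} {t : ℕ}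
    (hB : B * B = 1) (hAB : B * A * B = A ^ (2 ^ (t + 2) - 1)) {p : k[X]} (hp : Irreducible p)
    {u : V} (hu : u ≠ 0) (hAu : (A ^ 2 ^ (t + 2)) u = -u)
    (hpu : aeval (A + A ^ (2 ^ (t + 2) - 1)) p u = 0) :
    p.natDegree ≤ Module.finrank k (LinearMap.ker (B - 1)) := by
  set T := A + A ^ (2 ^ (t + 2) - 1) with hT
  have hTB : Commute T B := by
    have h1 : B * T * B = T := by
      rw [hT, mul_add, add_mul, ← hAB]
      have : B * (B * A * B) * B = A := by
        rw [show B * (B * A * B) * B = B * B * A * (B * B) by noncomm_ring, hB]; simp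
      rw [this, add_comm]
    have h2 : B * T * (B * B) = T * B := by rw [← mul_assoc, h1]
    rw [hB, mul_one] at h2
    exact h2.symm
  have hTA : Commute T A := (Commute.refl A).add_left ((Commute.refl A).pow_left _)
  have hBB (v : V) : B (B v) = v := by rw [← Module.End.mul_apply, hB, Module.End.one_apply]
  have hcomm {C : Module.End k V} (hC : Commute T C) {v : V} (hv : aeval T p v = 0) :
      aeval T p (C v) = 0 := by
    have : Commute C (aeval T p) := Algebra.commute_of_mem_adjoin_singleton_of_commute
      (aeval_mem_adjoin_singleton k T) hC.symm
    rw [← Module.End.mul_apply, ← this.eq, Module.End.mul_apply, hv, map_zero]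
  have hfix (v : V) (hv : aeval T p v = 0) (h0 : v + B v ≠ 0) :
      p.natDegree ≤ Module.finrank k (LinearMap.ker (B - 1)) := by
    refine natDegree_le_finrank_of_aeval_apply_eq_zero hp (T := T) (u := v + B v) ?_ ?_ h0 ?_
    · intro w hw
      rw [LinearMap.mem_ker, LinearMap.sub_apply, sub_eq_zero] at hw ⊢
      rw [← Module.End.mul_apply, ← hTB.eq, Module.End.mul_apply, hw]; rfl
    · rw [LinearMap.mem_ker, LinearMap.sub_apply, Module.End.one_apply, map_add, hBB]; abel
    · rw [map_add, hv, hcomm hTB hv, add_zero]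
  by_contra hlt
  have hu1 : B u = -u := by
    by_contra h
    exact hlt (hfix u hpu fun h' => h (eq_neg_of_add_eq_zero_right h'))
  have hu2 : B (A u) = -A u := by
    by_contra h
    exact hlt (hfix (A u) (hcomm hTA hpu) fun h' => h (eq_neg_of_add_eq_zero_right h'))
  have hm : (A ^ (2 ^ (t + 2) - 1)) u = A u := by
    rw [← hAB, Module.End.mul_apply, Module.End.mul_apply, hu1, map_neg, map_neg, hu2, neg_neg]
  have hA2 : (A ^ 2) u = -u := by
    rw [← hAu, ← Nat.sub_add_cancel (Nat.one_le_two_pow (n := t + 2)), pow_succ' A (_ - 1),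
      Module.End.mul_apply, hm, ← Module.End.mul_apply, ← sq]
  have hA4 : (A ^ 4) u = u := by
    rw [show 4 = 2 + 2 from rfl, pow_add, Module.End.mul_apply, hA2, map_neg, hA2, neg_neg]
  have hAn (n : ℕ) : ((A ^ 4) ^ n) u = u := by
    induction n with
    | zero => simp
    | succ n ih => rw [pow_succ, Module.End.mul_apply, hA4, ih]
  rw [show 2 ^ (t + 2) = 4 * 2 ^ t by ring, pow_mul, hAn] at hAu
  have h : (2 : k) • u = 0 := by rw [two_smul]; nth_rw 1 [hAu]; simp
  exact hu ((smul_eq_zero.mp h).resolve_left h2)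

/-- The field generated by `ε - ε⁻¹` is contained in the one generated by `ζ - ζ⁻¹` if `ε` is an
odd power of `ζ`. -/
theorem adjoin_pow_sub_inv_le {k K : Type*} [Field k] [Field K] [Algebra k K] {ζ : K} (hζ : ζ ≠ 0)
    {i : ℕ} (hi : Odd i) : IntermediateField.adjoin k {ζ ^ i - (ζ ^ i)⁻¹} ≤
      IntermediateField.adjoin k {ζ - ζ⁻¹} := by
  set E := IntermediateField.adjoin k {ζ - ζ⁻¹}
  have hθ : ζ - ζ⁻¹ ∈ E := IntermediateField.mem_adjoin_simple_self k _
  have key (n : ℕ) : ζ ^ n + (-ζ⁻¹) ^ n ∈ E := by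
    induction n using Nat.twoStepInduction with
    | zero => simpa using E.add_mem E.one_mem E.one_mem
    | one => simpa [sub_eq_add_neg] using hθ
    | more n h1 h2 =>
      have : ζ ^ (n + 2) + (-ζ⁻¹) ^ (n + 2) = (ζ - ζ⁻¹) * (ζ ^ (n + 1) + (-ζ⁻¹) ^ (n + 1)) +
          (ζ ^ n + (-ζ⁻¹) ^ n) := by
        have h : ζ * ζ⁻¹ = 1 := mul_inv_cancel₀ hζ
        linear_combination (ζ ^ n + (-ζ⁻¹) ^ n) * h
      rw [this]
      exact E.add_mem (E.mul_mem hθ h2) h1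
  rw [IntermediateField.adjoin_simple_le_iff]
  have := key i
  rwa [hi.neg_pow, inv_pow, ← sub_eq_add_neg] at this

open Polynomial in
/-- Lower bound for the dimension of a faithful representation of the semidihedral group. -/
theorem two_mul_finrank_le_of_semidihedral {k V : Type*} [Field k] (h2 : (2 : k) ≠ 0)
    [AddCommGroup V] [Module k V] [FiniteDimensional k V] {A B : Module.End k V} {t : ℕ}
    (hA : A ^ 2 ^ (t + 2) ≠ 1) (hA' : A ^ 2 ^ (t + 3) = 1)
    (hB : B * B = 1) (hAB : B * A * B = A ^ (2 ^ (t + 2) - 1))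
    {K : Type*} [Field K] [Algebra k K] [IsAlgClosed K] [Algebra.IsAlgebraic k K]
    {ε : K} (hε : ε ^ 2 ^ (t + 2) = -1) :
    2 * Module.finrank k (IntermediateField.adjoin k {ε - ε⁻¹}) ≤ Module.finrank k V := by
  have h2K : (2 : K) ≠ 0 := by
    have := (map_ne_zero (algebraMap k K)).mpr h2
    rwa [map_ofNat] at this
  have hf0 : (X ^ 2 ^ (t + 2) + 1 : k[X]) ≠ 0 := (monic_X_pow_add_C 1 (by positivity)).ne_zero
  have hnu : ¬ IsUnit (aeval A (X ^ 2 ^ (t + 2) + 1 : k[X])) := by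
    intro h
    apply hA
    have h0 : aeval A (X ^ 2 ^ (t + 2) + 1 : k[X]) * (A ^ 2 ^ (t + 2) - 1) = 0 := by
      simp only [map_add, map_pow, aeval_X, map_one]
      rw [show 2 ^ (t + 3) = 2 ^ (t + 2) + 2 ^ (t + 2) by ring, pow_add] at hA'
      rw [add_mul, mul_sub, hA']; simp
    exact sub_eq_zero.mp (h.mul_right_eq_zero.mp h0)
  obtain ⟨q, hq, hqf, hqA⟩ := exists_irreducible_dvd_not_isUnit_aeval hf0 hnu
  obtain ⟨u, hqu, hu⟩ := (Submodule.ne_bot_iff _).mp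
    (fun h => hqA ((LinearMap.isUnit_iff_ker_eq_bot _).mpr h))
  rw [LinearMap.mem_ker] at hqu
  have happ {g : k[X]} (hg : q ∣ g) : aeval A g u = 0 := by
    obtain ⟨r, rfl⟩ := hg
    rw [mul_comm, map_mul, Module.End.mul_apply, hqu, map_zero]
  have hAu : (A ^ 2 ^ (t + 2)) u = -u := by
    have := happ hqf
    simp only [map_add, map_pow, aeval_X, map_one, LinearMap.add_apply,
      Module.End.one_apply] at this
    exact eq_neg_of_add_eq_zero_left this
  obtain ⟨ζ, hζ⟩ := IsAlgClosed.exists_aeval_eq_zero K q (degree_pos_of_irreducible hq).ne'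
  have hζN : ζ ^ 2 ^ (t + 2) = -1 := by
    obtain ⟨r, hr⟩ := hqf
    have := congrArg (aeval ζ) hr
    simp only [map_add, map_pow, aeval_X, map_one, map_mul, hζ, zero_mul] at this
    exact eq_neg_of_add_eq_zero_left this
  have hζ0 : ζ ≠ 0 := by
    rintro rfl
    simp at hζN
  have hqmin {g : k[X]} (hg : aeval ζ g = 0) : q ∣ g := by
    have := minpoly.dvd k ζ hg
    rw [← minpoly.eq_of_irreducible hq hζ] at this
    exact dvd_of_mul_right_dvd this
  have hζm : ζ ^ (2 ^ (t + 2) - 1) = -ζ⁻¹ := by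
    rw [← mul_left_inj' hζ0, ← pow_succ, Nat.sub_add_cancel Nat.one_le_two_pow, hζN]
    simp [hζ0]
  set p := minpoly k (ζ - ζ⁻¹) with hpdef
  have hint : IsIntegral k (ζ - ζ⁻¹) := Algebra.IsIntegral.isIntegral _
  have hp : Irreducible p := minpoly.irreducible hint
  have hpu : aeval (A + A ^ (2 ^ (t + 2) - 1)) p u = 0 := by
    have hq' : q ∣ p.comp (X + X ^ (2 ^ (t + 2) - 1)) := by
      apply hqmin
      rw [aeval_comp, map_add, map_pow, aeval_X, hζm, ← sub_eq_add_neg]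
      exact minpoly.aeval ..
    have := happ hq'
    rwa [aeval_comp, map_add, map_pow, aeval_X] at this
  have hprim : orderOf ζ = 2 ^ (t + 3) := by
    have : Fact (Nat.Prime 2) := ⟨Nat.prime_two⟩
    apply orderOf_eq_prime_pow
    · rw [hζN]
      exact fun h => h2K (by linear_combination -h)
    · rw [pow_succ, pow_mul, hζN]; simp
  obtain ⟨i, -, rfl⟩ := (IsPrimitiveRoot.iff_orderOf.mpr hprim).eq_pow_of_pow_eq_one (ξ := ε)
    (by rw [pow_succ, pow_mul, hε]; simp)
  have hi : Odd i := by
    by_contra h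
    rw [Nat.not_odd_iff_even] at h
    rw [← pow_mul, mul_comm, pow_mul, hζN, h.neg_one_pow] at hε
    exact h2K (by linear_combination hε)
  have : FiniteDimensional k (IntermediateField.adjoin k {ζ - ζ⁻¹}) :=
    IntermediateField.adjoin.finiteDimensional hint
  have hdeg := IntermediateField.finrank_le_of_le_right (adjoin_pow_sub_inv_le (k := k) hζ0 hi)
  rw [IntermediateField.adjoin.finrank hint, ← hpdef] at hdeg
  have h₁ := natDegree_le_finrank_ker_sub_one h2 hB hAB hp hu hAu hpu
  have h₂ := natDegree_le_finrank_ker_sub_one h2 (B := -B) (by simpa using hB)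
    (by simpa using hAB) hp hu hAu hpu
  have hdisj : Disjoint (LinearMap.ker (B - 1)) (LinearMap.ker (-B - 1)) := by
    rw [Submodule.disjoint_def]
    intro v hv hv'
    simp only [LinearMap.mem_ker, LinearMap.sub_apply, LinearMap.neg_apply,
      Module.End.one_apply] at hv hv'
    have h : (2 : k) • v = 0 := by
      rw [two_smul, ← neg_eq_zero]
      calc -(v + v) = (B v - v) + (-B v - v) := by abel
        _ = 0 := by rw [hv, hv', add_zero]
    exact (smul_eq_zero.mp h).resolve_left h2
  have := Submodule.finrank_add_finrank_le_of_disjoint hdisj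
  omega

theorem stmt11 (k : Type*) [Field k] (hchar : ringChar k ≠ 2)
    (s : ℕ) (hs : 2 < s)
    (ε : AlgebraicClosure k) (hε : IsPrimitiveRoot ε (2 ^ s))
    -- `SD` is the semidihedral group of order `2 ^ (s + 1)`:
    (SD : Type*) [Group SD] [Fintype SD] (x y : SD)
    (hcard : Fintype.card SD = 2 ^ (s + 1))
    (hx : orderOf x = 2 ^ s) (hy : y ^ 2 = 1)
    (hxy : y * x * y = x ^ (2 ^ (s - 1) - 1))
    (hgen : Subgroup.closure {x, y} = ⊤) :
    minFaithfulDim k SD = 2 * Module.finrank k (IntermediateField.adjoin k {ε - ε⁻¹}) := by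
  have h2 : (2 : k) ≠ 0 := Ring.two_ne_zero hchar
  have hsplit : 2 ^ s = 2 ^ (s - 1) * 2 := by rw [← pow_succ, Nat.sub_add_cancel (by omega)]
  have hεN : ε ^ 2 ^ (s - 1) = -1 :=
    (hε.pow (by positivity) hsplit).eq_neg_one_of_two_right
  have hmem := exists_faithful_semidihedral_representation h2 hs hεN
    (Algebra.IsIntegral.isIntegral (R := k) _) hx hy hxy hgen
  refine le_antisymm (Nat.sInf_le hmem) (le_csInf ⟨_, hmem⟩ ?_)
  rintro d ⟨φ, hφ⟩
  obtain ⟨t, rfl⟩ := Nat.exists_eq_add_of_lt hs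
  rw [show 2 + t + 1 = t + 3 by omega] at *
  rw [show t + 3 - 1 = t + 2 by omega] at *
  let e : Matrix (Fin d) (Fin d) k ≃ₐ[k] Module.End k (Fin d → k) := Matrix.toLinAlgEquiv'
  let ρ : SD →* Module.End k (Fin d → k) :=
    (e : _ →* _).comp ((Units.coeHom _).comp φ)
  have hρ : Function.Injective ρ :=
    e.injective.comp (Units.val_injective.comp hφ)
  have hle := two_mul_finrank_le_of_semidihedral h2 (A := ρ x) (B := ρ y) (t := t) ?_ ?_ ?_ ?_ hεN
  · rwa [Module.finrank_fin_fun] at hle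
  · rw [← map_pow, ← map_one ρ]
    intro h
    have := Nat.le_of_dvd (by positivity) (orderOf_dvd_of_pow_eq_one (hρ h))
    rw [hx, hsplit] at this
    have : 0 < 2 ^ (t + 2) := by positivity
    omega
  · rw [← map_pow, ← hx, pow_orderOf_eq_one, map_one]
  · rw [← map_mul, ← sq, hy, map_one]
  · rw [← map_mul, ← map_mul, hxy, map_pow]
end

section
/- Let k be a field of characteristic ≠ 2, let s > 2 be an integer, and let ε be a primitive 2^s-th root of unity in a fixed algebraic closure of k. If there exists a k-algebra automorphism of k(ε) sending ε to ε^{2^{s−1}−1}, then [k(ε):k] = 2·[k(ε−ε⁻¹):k]; if no such automorphism exists, then k(ε) = k(ε−ε⁻¹), i.e. [k(ε):k] = [k(ε−ε⁻¹):k]. -/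
open IntermediateField

section SubInv

variable {k L : Type*} [Field k] [Field L] [Algebra k L] {x : L}

open Polynomial in
/-- If `x` is not in `k(x - x⁻¹)`, its minimal polynomial over that field is the obvious
quadratic. -/
theorem minpoly_adjoin_sub_inv (hx0 : x ≠ 0) (hx : x ∉ k⟮x - x⁻¹⟯) :
    minpoly k⟮x - x⁻¹⟯ x = X ^ 2 - C (AdjoinSimple.gen k (x - x⁻¹)) * X - 1 := by
  set p : (k⟮x - x⁻¹⟯)[X] := X ^ 2 - C (AdjoinSimple.gen k (x - x⁻¹)) * X - 1 with hp
  have hdeg : p.natDegree = 2 := by rw [hp]; compute_degree!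
  have hmonic : p.Monic := by rw [hp]; monicity!
  have hroot : aeval x p = 0 := by
    simp only [hp, map_sub, map_mul, map_pow, aeval_X, aeval_C, map_one,
      AdjoinSimple.algebraMap_gen]
    field_simp
    ring
  have hint : IsIntegral k⟮x - x⁻¹⟯ x := ⟨p, hmonic, hroot⟩
  refine (eq_of_monic_of_dvd_of_natDegree_le (minpoly.monic hint) hmonic
    (minpoly.dvd _ _ hroot) ?_).symm
  rw [hdeg, minpoly.two_le_natDegree_iff hint]
  rintro ⟨y, hy⟩
  exact hx (Set.mem_of_eq_of_mem hy.symm y.2)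

theorem restrictScalars_adjoin_sub_inv :
    (adjoin k⟮x - x⁻¹⟯ {x}).restrictScalars k = k⟮x⟯ := by
  rw [adjoin_simple_adjoin_simple]
  refine le_antisymm (adjoin_le_iff.2 ?_) (adjoin.mono _ _ _ (by simp))
  have hx := mem_adjoin_simple_self k x
  rintro y (rfl | rfl)
  · exact sub_mem hx (inv_mem hx)
  · exact hx

theorem finrank_adjoin_eq_two_mul_of_notMem (hx0 : x ≠ 0) (hx : x ∉ k⟮x - x⁻¹⟯) :
    Module.finrank k k⟮x⟯ = 2 * Module.finrank k k⟮x - x⁻¹⟯ := by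
  have hmin := minpoly_adjoin_sub_inv hx0 hx
  have hdeg : (minpoly k⟮x - x⁻¹⟯ x).natDegree = 2 := by rw [hmin]; compute_degree!
  have hint : IsIntegral k⟮x - x⁻¹⟯ x := by
    by_contra h
    simp [minpoly.eq_zero h] at hdeg
  have htower := Module.finrank_mul_finrank k k⟮x - x⁻¹⟯ (adjoin k⟮x - x⁻¹⟯ {x})
  rw [adjoin.finrank hint, hdeg] at htower
  rw [← restrictScalars_adjoin_sub_inv (k := k) (x := x), mul_comm, htower]
  rfl

theorem exists_algEquiv_neg_inv_of_notMem (hx0 : x ≠ 0) (hint : IsIntegral k x)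
    (hx : x ∉ k⟮x - x⁻¹⟯) :
    ∃ σ : k⟮x⟯ ≃ₐ[k] k⟮x⟯, σ (AdjoinSimple.gen k x) = -(AdjoinSimple.gen k x)⁻¹ := by
  have hroot : Polynomial.aeval (-x⁻¹) (minpoly k⟮x - x⁻¹⟯ x) = 0 := by
    rw [minpoly_adjoin_sub_inv hx0 hx]
    simp only [map_sub, map_mul, map_pow, Polynomial.aeval_X, Polynomial.aeval_C, map_one,
      AdjoinSimple.algebraMap_gen]
    field_simp
    ring
  have hroot' : Polynomial.aeval (-x⁻¹) (minpoly k x) = 0 := by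
    obtain ⟨q, hq⟩ := minpoly.dvd_map_of_isScalarTower k k⟮x - x⁻¹⟯ x
    rw [← Polynomial.aeval_map_algebraMap k⟮x - x⁻¹⟯, hq, map_mul, hroot, zero_mul]
  have hroot'' : Polynomial.aeval (-(AdjoinSimple.gen k x)⁻¹) (minpoly k x) = 0 := by
    apply (algebraMap k⟮x⟯ L).injective
    rw [← Polynomial.aeval_algebraMap_apply]
    simpa using hroot'
  have := adjoin.finiteDimensional hint
  let pb := adjoin.powerBasis hint
  have hgen : pb.gen = AdjoinSimple.gen k x := rfl
  have hpb : Polynomial.aeval (-(AdjoinSimple.gen k x)⁻¹) (minpoly k pb.gen) = 0 := by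
    rwa [hgen, minpoly_gen]
  refine ⟨AlgEquiv.ofBijective (pb.lift _ hpb) (Algebra.IsAlgebraic.algHom_bijective _), ?_⟩
  exact pb.lift_gen _ hpb

theorem notMem_adjoin_sub_inv_of_algEquiv (hx : x ≠ -x⁻¹) (σ : k⟮x⟯ ≃ₐ[k] k⟮x⟯)
    (hσ : σ (AdjoinSimple.gen k x) = -(AdjoinSimple.gen k x)⁻¹) : x ∉ k⟮x - x⁻¹⟯ := by
  intro hmem
  set g := AdjoinSimple.gen k x with hg
  have hfix : σ (g - g⁻¹) = g - g⁻¹ := by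
    rw [map_sub, map_inv₀, hσ, inv_neg, inv_inv]
    ring
  have hmap : k⟮g - g⁻¹⟯.map (val k⟮x⟯) = k⟮x - x⁻¹⟯ := by
    rw [adjoin_map, Set.image_singleton]
    simp [hg]
  rw [← hmap] at hmem
  obtain ⟨y, hy, hyx⟩ := hmem
  have hfixes : ∀ z ∈ k⟮g - g⁻¹⟯, σ z = z := by
    intro z hz
    induction hz using adjoin_induction with
    | mem z hz => rw [Set.mem_singleton_iff.1 hz]; exact hfix
    | algebraMap r => exact σ.commutes r
    | add a b _ _ ha hb => rw [map_add, ha, hb]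
    | inv a _ ha => rw [map_inv₀, ha]
    | mul a b _ _ ha hb => rw [map_mul, ha, hb]
  obtain rfl : y = g := Subtype.ext hyx
  have heq := hfixes _ hy
  rw [hσ] at heq
  exact hx (by simpa [hg] using (congrArg (algebraMap k⟮x⟯ L) heq).symm)

end SubInv



theorem stmt13 (k : Type*) [Field k] (hchar : ringChar k ≠ 2)
    (s : ℕ) (hs : 2 < s)
    (ε : AlgebraicClosure k) (hε : IsPrimitiveRoot ε (2 ^ s)) :
    ((∃ σ : k⟮ε⟯ ≃ₐ[k] k⟮ε⟯,
        σ (AdjoinSimple.gen k ε) = (AdjoinSimple.gen k ε) ^ (2 ^ (s - 1) - 1)) →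
      Module.finrank k (IntermediateField.adjoin k {ε}) =
        2 * Module.finrank k (IntermediateField.adjoin k {ε - ε⁻¹})) ∧
    (¬ (∃ σ : k⟮ε⟯ ≃ₐ[k] k⟮ε⟯,
        σ (AdjoinSimple.gen k ε) = (AdjoinSimple.gen k ε) ^ (2 ^ (s - 1) - 1)) →
      (IntermediateField.adjoin k {ε} : IntermediateField k (AlgebraicClosure k)) =
        IntermediateField.adjoin k {ε - ε⁻¹} ∧
      Module.finrank k (IntermediateField.adjoin k {ε}) =
        Module.finrank k (IntermediateField.adjoin k {ε - ε⁻¹})) := by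
  have hε0 : ε ≠ 0 := hε.ne_zero (by positivity)
  have hhalf : ε ^ 2 ^ (s - 1) = -1 := by
    have h : IsPrimitiveRoot (ε ^ 2 ^ (s - 1)) 2 :=
      hε.pow (by positivity) (by rw [← pow_succ]; congr 1; omega)
    exact h.eq_neg_one_of_two_right
  have hne : ε ≠ -ε⁻¹ := by
    intro h
    have h4 : ε ^ 4 = 1 := by
      have h2 : ε ^ 2 = -1 := by
        rw [sq]
        nth_rewrite 2 [h]
        simp [hε0]
      rw [show 4 = 2 * 2 from rfl, pow_mul, h2]
      norm_num
    have hdvd := Nat.le_of_dvd (by norm_num) (hε.dvd_of_pow_eq_one 4 h4)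
    have : 2 ^ 3 ≤ 2 ^ s := Nat.pow_le_pow_right (by norm_num) hs
    omega
  have hpow : (AdjoinSimple.gen k ε) ^ (2 ^ (s - 1) - 1) = -(AdjoinSimple.gen k ε)⁻¹ := by
    apply (algebraMap k⟮ε⟯ (AlgebraicClosure k)).injective
    rw [map_pow, map_neg, map_inv₀, AdjoinSimple.algebraMap_gen,
      pow_sub₀ _ hε0 Nat.one_le_two_pow, hhalf]
    simp
  rw [hpow]
  refine ⟨fun ⟨σ, hσ⟩ ↦ finrank_adjoin_eq_two_mul_of_notMem hε0
    (notMem_adjoin_sub_inv_of_algEquiv hne σ hσ), fun h ↦ ?_⟩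
  have hmem : ε ∈ k⟮ε - ε⁻¹⟯ := by
    by_contra hmem
    exact h (exists_algEquiv_neg_inv_of_notMem hε0 (Algebra.IsIntegral.isIntegral ε) hmem)
  have heq : k⟮ε⟯ = k⟮ε - ε⁻¹⟯ := by
    have hself := mem_adjoin_simple_self k ε
    exact le_antisymm (adjoin_simple_le_iff.2 hmem)
      (adjoin_simple_le_iff.2 (sub_mem hself (inv_mem hself)))
  exact ⟨heq, by rw [heq]⟩
end

section
/- Let k be a field of characteristic ≠ 2, let s > 2 be an integer, and let ε be a primitive 2^s-th root of unity in a fixed algebraic closure of k. If there exists a k-algebra automorphism of k(ε) sending ε to ε⁻¹, then [k(ε):k] = 2·[k(ε+ε⁻¹):k]; if no such automorphism exists, then k(ε) = k(ε+ε⁻¹), i.e. [k(ε):k] = [k(ε+ε⁻¹):k]. -/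
open IntermediateField

section InverseTrace

variable {k L : Type*} [Field k] [Field L] [Algebra k L] {x : L}

theorem adjoin_add_inv_le : k⟮x + x⁻¹⟯ ≤ k⟮x⟯ :=
  adjoin_simple_le_iff.mpr
    (add_mem (mem_adjoin_simple_self k x) (inv_mem (mem_adjoin_simple_self k x)))

theorem adjoin_eq_adjoin_add_inv (hx : x ∈ k⟮x + x⁻¹⟯) : k⟮x⟯ = k⟮x + x⁻¹⟯ :=
  le_antisymm (adjoin_simple_le_iff.mpr hx) adjoin_add_inv_le

/-- An automorphism inverting `x` fixes `k(x + x⁻¹)`, so it moves `x` out of that field. -/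
theorem notMem_adjoin_add_inv (hx0 : x ≠ 0) (hx : x ^ 2 ≠ 1) (σ : k⟮x⟯ ≃ₐ[k] k⟮x⟯)
    (hσ : σ (AdjoinSimple.gen k x) = (AdjoinSimple.gen k x)⁻¹) : x ∉ k⟮x + x⁻¹⟯ := by
  intro hmem
  let g := AdjoinSimple.gen k x
  have hfix : ∀ y (hy : y ∈ k⟮x + x⁻¹⟯),
      σ ⟨y, adjoin_add_inv_le hy⟩ = ⟨y, adjoin_add_inv_le hy⟩ := by
    intro y hy
    have hext : σ.toAlgHom.comp (inclusion adjoin_add_inv_le) =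
        inclusion (adjoin_add_inv_le (k := k) (x := x)) := by
      refine adjoin_algHom_ext k ?_
      rintro z rfl
      have hz : inclusion (adjoin_add_inv_le (k := k) (x := x))
          ⟨x + x⁻¹, mem_adjoin_simple_self k _⟩ = g + g⁻¹ := rfl
      have hsum : σ (g + g⁻¹) = g + g⁻¹ := by
        rw [map_add, map_inv₀, hσ, inv_inv, add_comm]
      rw [← hz] at hsum
      exact hsum
    exact DFunLike.congr_fun hext ⟨y, hy⟩
  have hinv : g⁻¹ = g := hσ.symm.trans (hfix x hmem)
  have hval : x⁻¹ = x := congrArg Subtype.val hinv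
  apply hx
  rw [pow_two]
  nth_rewrite 1 [← hval]
  exact inv_mul_cancel₀ hx0

theorem minpoly_adjoin_add_inv (hx0 : x ≠ 0) (hx : x ∉ k⟮x + x⁻¹⟯) :
    minpoly k⟮x + x⁻¹⟯ x =
      Polynomial.X ^ 2 - Polynomial.C (AdjoinSimple.gen k (x + x⁻¹)) * Polynomial.X + 1 := by
  set q : Polynomial k⟮x + x⁻¹⟯ :=
    Polynomial.X ^ 2 - Polynomial.C (AdjoinSimple.gen k (x + x⁻¹)) * Polynomial.X + 1 with hq
  have hqd : q.natDegree = 2 := by rw [hq]; compute_degree!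
  have hqm : q.Monic := by rw [hq]; monicity!
  have hqx : Polynomial.aeval x q = 0 := by
    simp [hq]
    field_simp
    ring
  have hint : IsIntegral k⟮x + x⁻¹⟯ x := ⟨q, hqm, hqx⟩
  refine (Polynomial.eq_of_monic_of_dvd_of_natDegree_le (minpoly.monic hint) hqm
    (minpoly.dvd _ _ hqx) ?_).symm
  rw [hqd, minpoly.two_le_natDegree_iff hint]
  rintro ⟨y, hy⟩
  exact hx (Set.mem_of_eq_of_mem hy.symm y.2)

theorem finrank_adjoin_eq_two_mul (hx0 : x ≠ 0) (hx : x ∉ k⟮x + x⁻¹⟯) :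
    Module.finrank k k⟮x⟯ = 2 * Module.finrank k k⟮x + x⁻¹⟯ := by
  have hmin := minpoly_adjoin_add_inv hx0 hx
  have hdeg : (minpoly k⟮x + x⁻¹⟯ x).natDegree = 2 := by rw [hmin]; compute_degree!
  have hint : IsIntegral k⟮x + x⁻¹⟯ x := by
    by_contra h
    simp [minpoly.eq_zero h] at hdeg
  have hadj : (k⟮x + x⁻¹⟯⟮x⟯).restrictScalars k = k⟮x⟯ := by
    rw [adjoin_simple_adjoin_simple]
    refine le_antisymm (adjoin_le_iff.mpr ?_) (adjoin.mono _ _ _ (by simp))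
    rintro y (rfl | rfl)
    · exact adjoin_add_inv_le (mem_adjoin_simple_self k _)
    · exact mem_adjoin_simple_self k _
  have hmul := Module.finrank_mul_finrank k k⟮x + x⁻¹⟯ (k⟮x + x⁻¹⟯⟮x⟯)
  rw [adjoin.finrank hint, hdeg] at hmul
  rw [← hadj, mul_comm]
  exact hmul.symm

theorem exists_algEquiv_gen_eq_inv (hx0 : x ≠ 0) (hint : IsIntegral k x)
    (hx : x ∉ k⟮x + x⁻¹⟯) :
    ∃ σ : k⟮x⟯ ≃ₐ[k] k⟮x⟯, σ (AdjoinSimple.gen k x) = (AdjoinSimple.gen k x)⁻¹ := by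
  have hroot : Polynomial.aeval x⁻¹ (minpoly k x) = 0 := by
    obtain ⟨r, hr⟩ := minpoly.dvd_map_of_isScalarTower k k⟮x + x⁻¹⟯ x
    rw [← Polynomial.aeval_map_algebraMap k⟮x + x⁻¹⟯, hr, minpoly_adjoin_add_inv hx0 hx, map_mul]
    refine mul_eq_zero_of_left ?_ _
    simp
    field_simp
    ring
  have hroot' : Polynomial.aeval (AdjoinSimple.gen k x)⁻¹ (minpoly k x) = 0 := by
    apply k⟮x⟯.val.injective
    change k⟮x⟯.val _ = k⟮x⟯.val 0
    rw [← Polynomial.aeval_algHom_apply]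
    simpa using hroot
  have := adjoin.finiteDimensional hint
  let φ : k⟮x⟯ →ₐ[k] k⟮x⟯ := (adjoin.powerBasis hint).lift (AdjoinSimple.gen k x)⁻¹
    (by simpa [adjoin.powerBasis_gen, minpoly_gen] using hroot')
  refine ⟨AlgEquiv.ofBijective φ φ.bijective, ?_⟩
  have := (adjoin.powerBasis hint).lift_gen (AdjoinSimple.gen k x)⁻¹
    (by simpa [adjoin.powerBasis_gen, minpoly_gen] using hroot')
  simpa [adjoin.powerBasis_gen] using this

end InverseTrace

theorem stmt14 (k : Type*) [Field k] (hchar : ringChar k ≠ 2)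
    (s : ℕ) (hs : 2 < s)
    (ε : AlgebraicClosure k) (hε : IsPrimitiveRoot ε (2 ^ s)) :
    ((∃ σ : k⟮ε⟯ ≃ₐ[k] k⟮ε⟯,
        σ (AdjoinSimple.gen k ε) = (AdjoinSimple.gen k ε)⁻¹) →
      Module.finrank k (IntermediateField.adjoin k {ε}) =
        2 * Module.finrank k (IntermediateField.adjoin k {ε + ε⁻¹})) ∧
    (¬ (∃ σ : k⟮ε⟯ ≃ₐ[k] k⟮ε⟯,
        σ (AdjoinSimple.gen k ε) = (AdjoinSimple.gen k ε)⁻¹) →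
      (IntermediateField.adjoin k {ε} : IntermediateField k (AlgebraicClosure k)) =
        IntermediateField.adjoin k {ε + ε⁻¹} ∧
      Module.finrank k (IntermediateField.adjoin k {ε}) =
        Module.finrank k (IntermediateField.adjoin k {ε + ε⁻¹})) := by
  have hx0 : ε ≠ 0 := hε.ne_zero (by positivity)
  have hx : ε ^ 2 ≠ 1 := by
    refine hε.pow_ne_one_of_pos_of_lt two_ne_zero ?_
    calc 2 = 2 ^ 1 := (pow_one 2).symm
      _ < 2 ^ s := Nat.pow_lt_pow_right one_lt_two (by omega)
  refine ⟨fun ⟨σ, hσ⟩ => finrank_adjoin_eq_two_mul hx0 (notMem_adjoin_add_inv hx0 hx σ hσ),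
    fun h => ?_⟩
  have heq : k⟮ε⟯ = k⟮ε + ε⁻¹⟯ := adjoin_eq_adjoin_add_inv <| by
    by_contra hmem
    exact h (exists_algEquiv_gen_eq_inv hx0 (Algebra.IsIntegral.isIntegral ε) hmem)
  exact ⟨heq, by rw [heq]⟩
end

section
/- Let k be a field of characteristic ≠ 2, let s > 1 be an integer, and let ε be a primitive 2^s-th root of unity in a fixed algebraic closure of k. Then the minimal faithful representation dimension over k of the dihedral group of order 2^{s+1} (the group ⟨x, y : x^{2^s} = y² = 1, yxy = x⁻¹⟩, Mathlib's DihedralGroup (2^s)) equals 2·[k(ε+ε⁻¹):k]. -/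
open Polynomial

/-- An element `x` of order `n`, not of order dividing `2`, inverted by an involution `y`,
generates together with `y` a dihedral group of order `2 * n`. -/
theorem DihedralGroup.exists_injective_of_relations {G : Type*} [Group G] {n : ℕ} {x y : G}
    (hx : orderOf x = n) (hx2 : x ^ 2 ≠ 1) (hy : y * y = 1) (hxy : y * x * y = x⁻¹) :
    ∃ φ : DihedralGroup n →* G, Function.Injective φ := by
  have hyinv : y⁻¹ = y := inv_eq_of_mul_eq_one_left hy
  have hcomm (a : ℤ) : x ^ a * y = y * x ^ (-a) := by
    have h : SemiconjBy y x x⁻¹ := by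
      rw [SemiconjBy, ← hxy, mul_assoc _ y y, hy, mul_one]
    have := (h.zpow_right (-a)).eq
    rw [inv_zpow, zpow_neg, inv_inv] at this
    rw [zpow_neg, this]
  have hcast (a : ℤ) : x ^ ((a : ZMod n).cast : ℤ) = x ^ a := by
    rw [ZMod.coe_intCast, ← hx, zpow_mod_orderOf]
  let f : DihedralGroup n → G
    | .r i => x ^ (i.cast : ℤ)
    | .sr i => y * x ^ (i.cast : ℤ)
  have hr (a : ℤ) : f (.r a) = x ^ a := hcast a
  have hsr (a : ℤ) : f (.sr a) = y * x ^ a := congrArg (y * ·) (hcast a)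
  have hmul (a b : DihedralGroup n) : f (a * b) = f a * f b := by
    rcases a with a | a <;> rcases b with b | b <;>
      obtain ⟨a, rfl⟩ := ZMod.intCast_surjective a <;>
      obtain ⟨b, rfl⟩ := ZMod.intCast_surjective b
    · rw [DihedralGroup.r_mul_r, ← Int.cast_add, hr, hr, hr, zpow_add]
    · rw [DihedralGroup.r_mul_sr, ← Int.cast_sub, hsr, hr, hsr, ← mul_assoc, hcomm, mul_assoc,
        ← zpow_add, neg_add_eq_sub]
    · rw [DihedralGroup.sr_mul_r, ← Int.cast_add, hsr, hsr, hr, mul_assoc, zpow_add]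
    · rw [DihedralGroup.sr_mul_sr, ← Int.cast_sub, hsr, hr, hsr, mul_assoc, ← mul_assoc (x ^ a),
        hcomm, ← mul_assoc, ← mul_assoc, hy, one_mul, ← zpow_add, neg_add_eq_sub]
  refine ⟨MonoidHom.mk' f hmul, (injective_iff_map_eq_one _).2 fun a ha => ?_⟩
  change f a = 1 at ha
  rcases a with a | a <;> obtain ⟨a, rfl⟩ := ZMod.intCast_surjective a
  · rw [hr, ← orderOf_dvd_iff_zpow_eq_one, hx] at ha
    rw [(ZMod.intCast_zmod_eq_zero_iff_dvd a n).2 ha, DihedralGroup.r_zero]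
  · rw [hsr] at ha
    have hyx : x * y = y * x := by
      rw [eq_inv_of_mul_eq_one_left ha, ← zpow_neg]
      exact (Commute.refl x).zpow_right _
    refine absurd ?_ hx2
    rw [pow_two, mul_eq_one_iff_eq_inv, ← hxy, ← hyx, mul_assoc, hy, mul_one]

/-- The companion matrix of `X ^ 2 - (ε + ε⁻¹) * X + 1` is diagonalised by its eigenvectors. -/
theorem companion_pow_mul_eigenvectors {F : Type*} [Field F] {ε : F} (hε : ε ≠ 0) (m : ℕ) :
    !![0, -1; 1, ε + ε⁻¹] ^ m * !![1, 1; -ε, -ε⁻¹] =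
      !![1, 1; -ε, -ε⁻¹] * Matrix.diagonal ![ε ^ m, ε⁻¹ ^ m] := by
  have h : SemiconjBy !![1, 1; -ε, -ε⁻¹] (Matrix.diagonal ![ε, ε⁻¹]) !![0, -1; 1, ε + ε⁻¹] := by
    ext i j
    fin_cases i <;> fin_cases j <;> simp [Matrix.mul_apply, Fin.sum_univ_two] <;> field_simp <;> ring
  have := (h.pow_right m).eq
  rw [← this, Matrix.diagonal_pow]
  congr 2
  ext i
  fin_cases i <;> rfl

/-- The companion matrix of `X ^ 2 - (ε + ε⁻¹) * X + 1` has the same order as `ε`. -/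
theorem companion_pow_eq_one_iff {F : Type*} [Field F] {ε : F} (hε : ε ≠ 0) (hε2 : ε ^ 2 ≠ 1)
    (m : ℕ) : !![0, -1; 1, ε + ε⁻¹] ^ m = (1 : Matrix (Fin 2) (Fin 2) F) ↔ ε ^ m = 1 := by
  have hP : IsUnit (!![1, 1; -ε, -ε⁻¹] : Matrix (Fin 2) (Fin 2) F) := by
    rw [Matrix.isUnit_iff_isUnit_det, Matrix.det_fin_two_of, isUnit_iff_ne_zero]
    intro h
    field_simp at h
    exact hε2 (by linear_combination h)
  have h := companion_pow_mul_eigenvectors hε m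
  constructor
  · intro h1
    rw [h1, one_mul, eq_comm, hP.mul_eq_left] at h
    simpa using congrFun (congrFun h 0) 0
  · intro h1
    rw [← hP.mul_eq_right, h, hP.mul_eq_left, inv_pow, h1, inv_one]
    ext i j
    fin_cases i <;> fin_cases j <;> rfl

/-- The companion matrix of `X ^ 2 - t * X + 1` as an invertible matrix. -/
def companionUnit {K : Type*} [CommRing K] (t : K) : Matrix.GeneralLinearGroup (Fin 2) K where
  val := !![0, -1; 1, t]
  inv := !![t, 1; -1, 0]
  val_inv := by ext i j; fin_cases i <;> fin_cases j <;> simp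
  inv_val := by ext i j; fin_cases i <;> fin_cases j <;> simp

/-- The matrix exchanging the two basis vectors as an invertible matrix. -/
def swapUnit (K : Type*) [CommRing K] : Matrix.GeneralLinearGroup (Fin 2) K where
  val := !![0, 1; 1, 0]
  inv := !![0, 1; 1, 0]
  val_inv := by ext i j; fin_cases i <;> fin_cases j <;> simp
  inv_val := by ext i j; fin_cases i <;> fin_cases j <;> simp

/-- If `K` contains `ε + ε⁻¹` with `ε` a primitive `n`-th root of unity, `n > 2`, then the dihedral
group of order `2 * n` has a faithful two-dimensional representation over `K`. -/
theorem exists_injective_dihedralGroup_GL_two {K F : Type*} [Field K] [Field F] [Algebra K F]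
    {n : ℕ} (hn : 2 < n) {ε : F} (hε : IsPrimitiveRoot ε n) (t : K)
    (ht : algebraMap K F t = ε + ε⁻¹) :
    ∃ φ : DihedralGroup n →* Matrix.GeneralLinearGroup (Fin 2) K, Function.Injective φ := by
  have hε2 : ε ^ 2 ≠ 1 := hε.pow_ne_one_of_pos_of_lt two_ne_zero hn
  have key (m : ℕ) : companionUnit t ^ m = 1 ↔ ε ^ m = 1 := by
    rw [← companion_pow_eq_one_iff (hε.ne_zero (by omega)) hε2 m, Units.ext_iff,
      Units.val_pow_eq_pow_val, Units.val_one, ← (Matrix.map_injective (algebraMap K F).injective).eq_iff]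
    change (algebraMap K F).mapMatrix _ = (algebraMap K F).mapMatrix _ ↔ _
    rw [map_pow, map_one]
    have : (algebraMap K F).mapMatrix (companionUnit t : Matrix (Fin 2) (Fin 2) K) =
        !![0, -1; 1, ε + ε⁻¹] := by
      ext i j
      fin_cases i <;> fin_cases j <;> simp [companionUnit, ht]
    rw [this]
  refine DihedralGroup.exists_injective_of_relations (x := companionUnit t) (y := swapUnit K)
    ?_ ?_ ?_ ?_
  · rw [hε.eq_orderOf]
    exact Nat.dvd_right_iff_eq.1 fun m => by
      rw [orderOf_dvd_iff_pow_eq_one, key, orderOf_dvd_iff_pow_eq_one]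
  · rwa [Ne, key]
  · ext i j
    fin_cases i <;> fin_cases j <;> simp [swapUnit]
  · refine Units.ext ?_
    change !![0, 1; 1, 0] * !![0, -1; 1, t] * !![0, 1; 1, 0] = !![t, 1; -1, 0]
    ext i j
    fin_cases i <;> fin_cases j <;> simp

/-- Restriction of scalars embeds `GL m K` into `GL (m * [K : k]) k`. -/
theorem exists_injective_GL_restrictScalars (k K : Type*) [Field k] [Field K] [Algebra k K]
    [FiniteDimensional k K] (m : ℕ) :
    ∃ φ : Matrix.GeneralLinearGroup (Fin m) K →*
      Matrix.GeneralLinearGroup (Fin (m * Module.finrank k K)) k, Function.Injective φ := by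
  let b := Module.finBasis k K
  let f : Matrix (Fin m) (Fin m) K →+* Matrix (Fin (m * Module.finrank k K))
      (Fin (m * Module.finrank k K)) k :=
    (Matrix.reindexAlgEquiv k k finProdFinEquiv).toRingEquiv.toRingHom.comp
      ((Matrix.compRingEquiv (Fin m) (Fin (Module.finrank k K)) k).toRingHom.comp
        (Algebra.leftMulMatrix b).toRingHom.mapMatrix)
  have hf : Function.Injective f :=
    (Matrix.reindexAlgEquiv k k finProdFinEquiv).injective.comp
      ((Matrix.compRingEquiv (Fin m) (Fin (Module.finrank k K)) k).injective.comp
        (Matrix.map_injective (Algebra.leftMulMatrix_injective b)))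
  exact ⟨Units.map f, Units.map_injective hf⟩

/-- `ε ^ j + ε⁻¹ ^ j` is a polynomial in `ε + ε⁻¹`. -/
theorem pow_add_inv_pow_mem_adjoin {k F : Type*} [Field k] [Field F] [Algebra k F] {ε : F}
    (hε : ε ≠ 0) (j : ℕ) :
    ε ^ j + ε⁻¹ ^ j ∈ IntermediateField.adjoin k {ε + ε⁻¹} := by
  have hgen := IntermediateField.mem_adjoin_simple_self k (ε + ε⁻¹)
  induction j using Nat.twoStepInduction with
  | zero => simpa using add_mem (one_mem _) (one_mem _)
  | one => simpa using hgen
  | more j h0 h1 =>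
    convert sub_mem (mul_mem hgen h1) h0 using 1
    linear_combination (-(ε ^ j + ε⁻¹ ^ j)) * mul_inv_cancel₀ hε

/-- The roots of the characteristic polynomial of a matrix over `k`, in an extension of `k`, are
permuted by `k`-endomorphisms. -/
theorem algHom_mem_spectrum_map {k F : Type*} [Field k] [Field F] [Algebra k F] {m : ℕ}
    (A : Matrix (Fin m) (Fin m) k) (σ : F →ₐ[k] F) {z : F}
    (hz : z ∈ spectrum F (A.map (algebraMap k F))) :
    σ z ∈ spectrum F (A.map (algebraMap k F)) := by
  rw [Matrix.mem_spectrum_iff_isRoot_charpoly, Matrix.charpoly_map, IsRoot.def, eval_map_algebraMap]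
    at hz ⊢
  rw [aeval_algHom_apply, hz, map_zero]

/-- An `m × m` matrix has at most `m` eigenvalues. -/
theorem card_le_of_subset_spectrum {F : Type*} [Field F] {m : ℕ} (A : Matrix (Fin m) (Fin m) F)
    (s : Finset F) (hs : (s : Set F) ⊆ spectrum F A) : s.card ≤ m := by
  classical
  have hsub : s ⊆ A.charpoly.roots.toFinset := fun z hz => by
    rw [Multiset.mem_toFinset, mem_roots A.charpoly_monic.ne_zero]
    exact Matrix.mem_spectrum_iff_isRoot_charpoly.1 (hs hz)
  calc s.card ≤ A.charpoly.roots.toFinset.card := Finset.card_le_card hsub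
    _ ≤ A.charpoly.roots.card := Multiset.toFinset_card_le _
    _ ≤ A.charpoly.natDegree := card_roots' _
    _ = m := by simp

/-- A matrix over `k` with eigenvalues `ζ` and `ζ⁻¹`, where `ζ` is separable over `k` and
`ζ ^ 2 ≠ 1`, has size at least `2 * [k(ζ + ζ⁻¹) : k]`. -/
theorem two_mul_finrank_adjoin_le {k F : Type*} [Field k] [Field F] [Algebra k F]
    [IsAlgClosed F] [Algebra.IsAlgebraic k F] {m : ℕ} (A : Matrix (Fin m) (Fin m) k)
    {ζ : F} (hsep : IsSeparable k ζ) (hζ0 : ζ ≠ 0) (hζ2 : ζ ^ 2 ≠ 1)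
    (hζ : ζ ∈ spectrum F (A.map (algebraMap k F)))
    (hζinv : ζ⁻¹ ∈ spectrum F (A.map (algebraMap k F))) :
    2 * Module.finrank k (IntermediateField.adjoin k {ζ + ζ⁻¹}) ≤ m := by
  classical
  let K := IntermediateField.adjoin k {ζ + ζ⁻¹}
  have : Algebra.IsSeparable k K :=
    (IntermediateField.isSeparable_adjoin_simple_iff_isSeparable _ _).2
      (Field.isSeparable_add hsep (Field.isSeparable_inv hsep))
  have : FiniteDimensional k K :=
    IntermediateField.adjoin.finiteDimensional (Algebra.IsIntegral.isIntegral _)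
  choose g hg using fun τ : K →ₐ[k] F =>
    IntermediateField.exists_algHom_of_splits (L := K) (E := F)
      (fun z => ⟨Algebra.IsIntegral.isIntegral z, IsAlgClosed.splits _⟩) τ
  let w (p : (K →ₐ[k] F) × Bool) : F := g p.1 (if p.2 then ζ else ζ⁻¹)
  have hne : ζ ≠ ζ⁻¹ := fun h => hζ2 <| by rw [pow_two, ← mul_inv_cancel₀ hζ0, ← h]
  have hsum (p) : w p + (w p)⁻¹ = p.1 (IntermediateField.AdjoinSimple.gen k (ζ + ζ⁻¹)) := by
    rcases p with ⟨τ, b⟩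
    have h : g τ (ζ + ζ⁻¹) = τ (IntermediateField.AdjoinSimple.gen k (ζ + ζ⁻¹)) :=
      DFunLike.congr_fun (hg τ) (IntermediateField.AdjoinSimple.gen k (ζ + ζ⁻¹))
    rw [← h]
    cases b <;> simp [w, add_comm]
  have hw : Function.Injective w := by
    intro p q hpq
    have h1 : p.1 = q.1 := IntermediateField.algHom_ext_of_eq_adjoin k rfl fun z hz => by
      obtain rfl : z = ζ + ζ⁻¹ := hz
      exact (hsum p).symm.trans ((congrArg (fun z => z + z⁻¹) hpq).trans (hsum q))
    rcases p with ⟨τ, b⟩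
    rcases q with ⟨τ', c⟩
    obtain rfl : τ = τ' := h1
    have h2 := (g τ).injective hpq
    cases b <;> cases c <;> simp_all
  have hcard : (Finset.univ.image w).card = 2 * Module.finrank k K := by
    rw [Finset.card_image_of_injective _ hw, Finset.card_univ, Fintype.card_prod, AlgHom.card,
      Fintype.card_bool, mul_comm]
  rw [← hcard]
  refine card_le_of_subset_spectrum (A.map (algebraMap k F)) _ fun z hz => ?_
  obtain ⟨⟨τ, b⟩, -, rfl⟩ := Finset.mem_image.1 (Finset.mem_coe.1 hz)
  refine algHom_mem_spectrum_map A (g τ) ?_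
  cases b
  · exact hζinv
  · exact hζ

/-- A unit conjugate to its inverse has spectrum closed under inversion. -/
theorem inv_mem_spectrum_of_conj_eq_inv {F A : Type*} [Field F] [Ring A] [Algebra F A] {x y : Aˣ}
    (hxy : y * x * y⁻¹ = x⁻¹) {z : F} (hz : z ∈ spectrum F (x : A)) :
    z⁻¹ ∈ spectrum F (x : A) := by
  rw [← spectrum.units_conjugate (u := y), ← Units.val_mul, ← Units.val_mul, hxy,
    ← spectrum.map_inv, Set.inv_mem_inv]
  exact hz

/-- A nontrivial involution has `-1` in its spectrum. -/
theorem neg_one_mem_spectrum {F A : Type*} [Field F] [Ring A] [Algebra F A] {B : A}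
    (hB : B ^ 2 = 1) (hB1 : B ≠ 1) : -1 ∈ spectrum F B := by
  intro h
  refine hB1 (sub_eq_zero.1 (h.mul_left_eq_zero.1 ?_))
  rw [map_neg, map_one]
  have : (B - 1) * (-1 - B) = 1 - B ^ 2 := by noncomm_ring
  rw [this, hB, sub_self]

/-- A faithful representation over `k` of the dihedral group of order `2 ^ (s + 1)` has dimension at
least `2 * [k(ε + ε⁻¹) : k]`. -/
theorem two_mul_finrank_le_of_injective {k F : Type*} [Field k] [Field F] [Algebra k F]
    [IsAlgClosed F] [Algebra.IsAlgebraic k F] (hchar : (2 : k) ≠ 0) {s : ℕ} (hs : 1 < s) {ε : F}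
    (hε : IsPrimitiveRoot ε (2 ^ s)) {m : ℕ}
    (φ : DihedralGroup (2 ^ s) →* Matrix.GeneralLinearGroup (Fin m) k)
    (hφ : Function.Injective φ) :
    2 * Module.finrank k (IntermediateField.adjoin k {ε + ε⁻¹}) ≤ m := by
  obtain ⟨s, rfl⟩ : ∃ r, s = r + 1 := ⟨s - 1, by omega⟩
  have hcharF : (2 : F) ≠ 0 := by
    rw [← map_ofNat (algebraMap k F) 2]
    exact (_root_.map_ne_zero _).2 hchar
  let ψ := (Matrix.GeneralLinearGroup.map (n := Fin m) (algebraMap k F)).comp φ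
  have hψ : Function.Injective ψ := fun a b hab => hφ <| Units.ext <|
    Matrix.map_injective (algebraMap k F).injective (congrArg Units.val hab)
  let x := ψ (.r 1)
  have hx : orderOf x = 2 ^ (s + 1) := by
    rw [orderOf_injective ψ hψ, DihedralGroup.orderOf_r_one]
  have hxy : ψ (.sr 0) * x * (ψ (.sr 0))⁻¹ = x⁻¹ := by
    simp only [x, ← map_mul, ← map_inv]
    congr 1
    simp
  have hneg : (-1 : F) ∈ spectrum F ((x : Matrix (Fin m) (Fin m) F) ^ 2 ^ s) := by
    apply neg_one_mem_spectrum
    · rw [← pow_mul, ← pow_succ, ← Units.val_pow_eq_pow_val, ← hx, pow_orderOf_eq_one,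
        Units.val_one]
    · rw [← Units.val_pow_eq_pow_val, Ne, Units.val_eq_one, ← orderOf_dvd_iff_pow_eq_one, hx]
      exact fun h => absurd (Nat.pow_dvd_pow_iff_le_right (le_refl 2) |>.1 h) (by omega)
  rw [spectrum.map_pow_of_pos _ (by positivity)] at hneg
  obtain ⟨ζ, hζ, hζneg⟩ := hneg
  replace hζneg : ζ ^ 2 ^ s = -1 := hζneg
  have hneg1 : (-1 : F) ≠ 1 := fun h => hcharF (by linear_combination -h)
  have hζprim : IsPrimitiveRoot ζ (2 ^ (s + 1)) := by
    rw [← orderOf_eq_prime_pow (p := 2) (x := ζ) (n := s) (by rwa [hζneg])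
      (by rw [pow_succ, pow_mul, hζneg, neg_one_sq])]
    exact IsPrimitiveRoot.orderOf ζ
  have hζ0 : ζ ≠ 0 := hζprim.ne_zero (by positivity)
  have hlt : 2 < 2 ^ (s + 1) := by
    simpa using Nat.pow_lt_pow_right (a := 2) (by norm_num) hs
  have hsep : IsSeparable k ζ := by
    have h2 : ((2 ^ (s + 1) : ℕ) : k) ≠ 0 := by
      rw [Nat.cast_pow, Nat.cast_ofNat]
      exact pow_ne_zero _ hchar
    refine (separable_X_pow_sub_C (1 : k) h2 one_ne_zero).of_dvd (minpoly.dvd _ _ ?_)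
    simp [hζprim.pow_eq_one]
  obtain ⟨j, -, rfl⟩ := hζprim.eq_pow_of_pow_eq_one hε.pow_eq_one
  have hfin : FiniteDimensional k (IntermediateField.adjoin k {ζ + ζ⁻¹}) :=
    IntermediateField.adjoin.finiteDimensional (Algebra.IsIntegral.isIntegral _)
  refine le_trans (Nat.mul_le_mul_left 2 ?_) (two_mul_finrank_adjoin_le
    (φ (.r 1) : Matrix (Fin m) (Fin m) k) hsep hζ0
    (hζprim.pow_ne_one_of_pos_of_lt two_ne_zero hlt) hζ (inv_mem_spectrum_of_conj_eq_inv hxy hζ))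
  refine IntermediateField.finrank_le_of_le_right ?_
  rw [IntermediateField.adjoin_simple_le_iff, ← inv_pow]
  exact pow_add_inv_pow_mem_adjoin hζ0 j

theorem stmt15 (k : Type*) [Field k] (hchar : ringChar k ≠ 2)
    (s : ℕ) (hs : 1 < s)
    (ε : AlgebraicClosure k) (hε : IsPrimitiveRoot ε (2 ^ s)) :
    minFaithfulDim k (DihedralGroup (2 ^ s)) =
      2 * Module.finrank k (IntermediateField.adjoin k {ε + ε⁻¹}) := by
  have hlt : 2 < 2 ^ s := by
    simpa using Nat.pow_lt_pow_right (a := 2) (by norm_num) hs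
  have : FiniteDimensional k (IntermediateField.adjoin k {ε + ε⁻¹}) :=
    IntermediateField.adjoin.finiteDimensional (Algebra.IsIntegral.isIntegral _)
  refine IsLeast.csInf_eq ⟨?_, ?_⟩
  · obtain ⟨φ, hφ⟩ := exists_injective_dihedralGroup_GL_two hlt hε
      (IntermediateField.AdjoinSimple.gen k (ε + ε⁻¹)) rfl
    obtain ⟨ρ, hρ⟩ := exists_injective_GL_restrictScalars k
      (IntermediateField.adjoin k {ε + ε⁻¹}) 2
    exact ⟨ρ.comp φ, hρ.comp hφ⟩
  · rintro m ⟨φ, hφ⟩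
    exact two_mul_finrank_le_of_injective (Ring.two_ne_zero hchar) hs hε φ hφ
end
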